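/- arXiv:1105.0507 — 2 statements merged into one kernel-verified Lean document; each statement's English description precedes it below -/
import Mathlib

section
/- Let Γ be a gem of a connected n-manifold M, n ≥ 3, R a ρ_n-pair of Γ, Γ' the switching of R, and let Γ̃ be obtained from Γ' by adding a blob (n-dipole) with new vertices A, B on the new edge f'. Then the vertices e(0) and B are completely separated in Γ̃, and Γ is colour-isomorphic to the fusion graph Γ̃ fus(e(0), B). -/
open Set

/-- An `(n+1)`-coloured graph on vertex set `V`: for each colour `c ∈ {0,…,n}` a
fixed-point-free involution pairing the endpoints of the `c`-coloured edges. -/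
structure PCG (n : ℕ) (V : Type) where
  inv : Fin (n + 1) → V → V
  involutive : ∀ c, Function.Involutive (inv c)
  fixedfree : ∀ c v, inv c v ≠ v

namespace PCG

variable {n : ℕ} {V : Type}

/-- One step along an edge whose colour lies in `B`. -/
def step (Γ : PCG n V) (B : Set (Fin (n + 1))) (a b : V) : Prop :=
  ∃ c ∈ B, Γ.inv c a = b

/-- Reachability in the subgraph of edges whose colours lie in `B`. -/
def reach (Γ : PCG n V) (B : Set (Fin (n + 1))) : V → V → Prop :=
  Relation.ReflTransGen (Γ.step B)

/-- `x` and `y` lie on the same `{c,i}`-bicoloured cycle. -/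
def sameCycle (Γ : PCG n V) (c i : Fin (n + 1)) (x y : V) : Prop :=
  Γ.reach {c, i} x y

/-- Number of connected components of the subgraph of colours in `B`. -/
noncomputable def numComp (Γ : PCG n V) (B : Set (Fin (n + 1))) : ℕ :=
  Nat.card (Quot (Γ.reach B))

/-- Number of connected components of the subgraph of colours in `B`,
restricted to the vertex set `S`. -/
noncomputable def numCompOn (Γ : PCG n V) (B : Set (Fin (n + 1))) (S : Set V) : ℕ :=
  Nat.card (Quot (Relation.ReflTransGen
    (fun a b : S => ∃ c ∈ B, Γ.inv c (a : V) = (b : V))))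

/-- The `c`-coloured edges `{x, Γ.inv c x}` and `{y, Γ.inv c y}` are distinct. -/
def EdgesNe (Γ : PCG n V) (c : Fin (n + 1)) (x y : V) : Prop :=
  y ≠ x ∧ y ≠ Γ.inv c x

/-- A `ρₙ`-pair involving colour `c`, represented by endpoints `x` of `e` and `y` of `f`. -/
def IsRhoN (Γ : PCG n V) (c : Fin (n + 1)) (x y : V) : Prop :=
  Γ.EdgesNe c x y ∧ ∀ i, i ≠ c → Γ.sameCycle c i x y

/-- A `ρ_{n-1}`-pair involving colour `c` and not involving colour `d`. -/
def IsRhoN1 (Γ : PCG n V) (c d : Fin (n + 1)) (x y : V) : Prop :=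
  Γ.EdgesNe c x y ∧ d ≠ c ∧ ¬Γ.sameCycle c d x y ∧
    ∀ j, j ≠ c → j ≠ d → Γ.sameCycle c j x y

/-- `Γ` is rigid: it contains no `ρ`-pairs. -/
def Rigid (Γ : PCG n V) : Prop :=
  (¬∃ c x y, Γ.IsRhoN c x y) ∧ ¬∃ c d x y, Γ.IsRhoN1 c d x y

/-- A `ρ`-pair of maximal type of the `î`-residue containing it: two `c`-coloured
edges (`c ≠ i`) of the same `î`-residue lying on a common `{c,j}`-cycle for every
colour `j` of the residue different from `c`. -/
def IsRhoSubMax (Γ : PCG n V) (i c : Fin (n + 1)) (x y : V) : Prop :=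
  c ≠ i ∧ Γ.EdgesNe c x y ∧ Γ.reach {i}ᶜ x y ∧
    ∀ j, j ≠ c → j ≠ i → Γ.sameCycle c j x y

/-- `Γ'` is obtained from `Γ` by a switching of the pair of `c`-coloured edges at `x` and `y`:
delete the two edges and reconnect the four endpoints in one of the two other ways. -/
def IsSwitch (Γ Γ' : PCG n V) (c : Fin (n + 1)) (x y : V) : Prop :=
  (∀ i, i ≠ c → Γ'.inv i = Γ.inv i) ∧
  (∀ v, v ≠ x → v ≠ y → v ≠ Γ.inv c x → v ≠ Γ.inv c y → Γ'.inv c v = Γ.inv c v) ∧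
  ((Γ'.inv c x = y ∧ Γ'.inv c (Γ.inv c x) = Γ.inv c y) ∨
    (Γ'.inv c x = Γ.inv c y ∧ Γ'.inv c (Γ.inv c x) = y))

/-- The standard (orientation-coherent) switching of a `ρₙ`-pair: with respect to any
proper 2-colouring of any `{c,i}`-bicoloured subgraph, `x = e(0)` gets joined to a vertex
in the opposite class, i.e. to the head `f(1)` of `f`. -/
def IsStdSwitch (Γ Γ' : PCG n V) (c : Fin (n + 1)) (x y : V) : Prop :=
  Γ.IsSwitch Γ' c x y ∧
  ∀ i, i ≠ c → ∀ b : V → Bool, (∀ w, b (Γ.inv c w) ≠ b w) →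
    (∀ w, b (Γ.inv i w) ≠ b w) → b (Γ'.inv c x) ≠ b x

/-- The standard switching of a `ρ_{n-1}`-pair not involving colour `d`: with respect to
any bipartition of the `d̂`-residues, `x = e(0)` gets joined to a vertex of the opposite
class. -/
def IsStdSwitchN1 (Γ Γ' : PCG n V) (c d : Fin (n + 1)) (x y : V) : Prop :=
  Γ.IsSwitch Γ' c x y ∧
  ∀ b : V → Bool, (∀ j, j ≠ d → ∀ w, b (Γ.inv j w) ≠ b w) → b (Γ'.inv c x) ≠ b x

/-- `Γ` is bipartite. -/
def Bipartite (Γ : PCG n V) : Prop :=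
  ∃ b : V → Bool, ∀ c v, b (Γ.inv c v) ≠ b v

/-- `S` is a union of connected components splitting `Γ` into exactly two
connected pieces `S` and `Sᶜ`. -/
def SplitsTwo (Γ : PCG n V) (S : Set V) : Prop :=
  S.Nonempty ∧ Sᶜ.Nonempty ∧ (∀ v ∈ S, ∀ c, Γ.inv c v ∈ S) ∧
  (∀ u ∈ S, ∀ v ∈ S, Γ.reach Set.univ u v) ∧
  (∀ u ∈ Sᶜ, ∀ v ∈ Sᶜ, Γ.reach Set.univ u v)

/-- The geometric realization `|K(Γ)|` of the part of `Γ` spanned by the vertex set `S`: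
one `n`-simplex per vertex, glued along the faces opposite to `c` according to the
`c`-coloured edges. -/
abbrev RealSp (Γ : PCG n V) (S : Set V) : Type :=
  Quot (fun a b : (Σ _ : S, ↥(stdSimplex ℝ (Fin (n + 1)))) =>
    ∃ c : Fin (n + 1), (b.1 : V) = Γ.inv c a.1 ∧ b.2 = a.2 ∧ (a.2 : Fin (n + 1) → ℝ) c = 0)

/-- The geometric realization of the part of the `î`-residue subgraph spanned by `S`:
one `(n-1)`-simplex (with vertices labelled by the colours `≠ i`) per vertex. -/
abbrev ResRealSp (Γ : PCG n V) (i : Fin (n + 1)) (S : Set V) : Type :=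
  Quot (fun a b : (Σ _ : S, ↥(stdSimplex ℝ {j : Fin (n + 1) // j ≠ i})) =>
    ∃ c : {j : Fin (n + 1) // j ≠ i},
      (b.1 : V) = Γ.inv c a.1 ∧ b.2 = a.2 ∧ (a.2 : {j : Fin (n + 1) // j ≠ i} → ℝ) c = 0)

/-- `Γ` is a gem of the space `X`, i.e. `|K(Γ)| ≅ X`. -/
def IsGemOf (Γ : PCG n V) (X : Type) [TopologicalSpace X] : Prop :=
  Nonempty (Γ.RealSp Set.univ ≃ₜ X)

/-- `Γ` is a crystallization of `X`: a gem of `X` all of whose `ĉ`-residue subgraphs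
are connected. -/
def IsCrystallization (Γ : PCG n V) (X : Type) [TopologicalSpace X] : Prop :=
  Γ.IsGemOf X ∧ ∀ c : Fin (n + 1), ∀ u v : V, Γ.reach {c}ᶜ u v

end PCG

/-- The `m`-dimensional sphere. -/
abbrev sphereType (m : ℕ) : Type :=
  ↥(Metric.sphere (0 : EuclideanSpace ℝ (Fin (m + 1))) 1)

/-- `Z` is a closed topological `m`-manifold (possibly disconnected). -/
def IsClosedManifoldN (m : ℕ) (Z : Type) [TopologicalSpace Z] : Prop :=
  T2Space Z ∧ CompactSpace Z ∧
    ∀ z : Z, ∃ U : Set Z, z ∈ U ∧ IsOpen U ∧ Nonempty (U ≃ₜ EuclideanSpace ℝ (Fin m))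

/-- `X` is a connected sum of `X₁` and `X₂` (`m`-dimensional): `X` decomposes into two
pieces, homeomorphic to the complements of open balls in `X₁` and `X₂`, glued along a
sphere. -/
def IsConnSum (m : ℕ) (X X₁ X₂ : Type) [TopologicalSpace X]
    [TopologicalSpace X₁] [TopologicalSpace X₂] : Prop :=
  ∃ (C₁ : Set X₁) (C₂ : Set X₂) (A₁ A₂ : Set X),
    Nonempty (C₁ ≃ₜ (Metric.closedBall (0 : EuclideanSpace ℝ (Fin m)) 1 :
      Set (EuclideanSpace ℝ (Fin m)))) ∧
    Nonempty (C₂ ≃ₜ (Metric.closedBall (0 : EuclideanSpace ℝ (Fin m)) 1 :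
      Set (EuclideanSpace ℝ (Fin m)))) ∧
    A₁ ∪ A₂ = Set.univ ∧
    Nonempty (↥(A₁ ∩ A₂) ≃ₜ (Metric.sphere (0 : EuclideanSpace ℝ (Fin m)) 1 :
      Set (EuclideanSpace ℝ (Fin m)))) ∧
    Nonempty (A₁ ≃ₜ ((interior C₁)ᶜ : Set X₁)) ∧
    Nonempty (A₂ ≃ₜ ((interior C₂)ᶜ : Set X₂))

/-- The twisted `m`-sphere bundle over `S¹`: the mapping torus of a reflection of `Sᵐ`. -/
abbrev TwistedBundle (m : ℕ) : Type :=
  Quot (fun a b : sphereType m × ℝ =>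
    b.2 = a.2 + 1 ∧ (b.1 : EuclideanSpace ℝ (Fin (m + 1))) =
      fun i => if i = 0 then -((a.1 : EuclideanSpace ℝ (Fin (m + 1))) i)
               else (a.1 : EuclideanSpace ℝ (Fin (m + 1))) i)

/-- A handle of dimension `n`: `S^{n-1} × S¹` or the twisted `S^{n-1}`-bundle over `S¹`. -/
def IsHandleDim (n : ℕ) (H : Type) [TopologicalSpace H] : Prop :=
  Nonempty (H ≃ₜ sphereType (n - 1) × sphereType 1) ∨ Nonempty (H ≃ₜ TwistedBundle (n - 1))

/-- `X` is handle-free: it is not a connected sum of anything with a handle. -/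
def HandleFree (n : ℕ) (X : Type) [TopologicalSpace X] : Prop :=
  ¬∃ (Y H : Type) (_ : TopologicalSpace Y) (_ : TopologicalSpace H),
    IsHandleDim n H ∧ IsConnSum n X Y H

namespace Stmt8

/-- mod 2 chains of tuples -/
abbrev Ch (P : Type) := List P →₀ ZMod 2

noncomputable def sg {P : Type} (l : List P) : Ch P := Finsupp.single l 1

noncomputable def lext {P M : Type} [AddCommGroup M] [Module (ZMod 2) M] (f : List P → M) :
    Ch P →ₗ[ZMod 2] M := Finsupp.linearCombination (ZMod 2) f

@[simp] lemma lext_sg {P M : Type} [AddCommGroup M] [Module (ZMod 2) M] (f : List P → M)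
    (l : List P) : lext f (sg l) = f l := by
  simp [lext, sg]

lemma lin_ext {P M : Type} [AddCommGroup M] [Module (ZMod 2) M]
    {f g : Ch P →ₗ[ZMod 2] M} (h : ∀ l, f (sg l) = g (sg l)) : f = g := by
  apply Finsupp.lhom_ext'
  intro l
  ext
  simpa [sg] using h l

lemma add_self' {P : Type} (z : Ch P) : z + z = 0 := by
  ext l
  simp [CharTwo.add_self_eq_zero]

noncomputable def cone {P : Type} (p : P) : Ch P →ₗ[ZMod 2] Ch P := lext (fun l => sg (p :: l))

@[simp] lemma cone_sg {P : Type} (p : P) (l : List P) : cone p (sg l) = sg (p :: l) := by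
  simp [cone]

noncomputable def bdL {P : Type} : List P → Ch P
  | [] => 0
  | p :: l => sg l + cone p (bdL l)

noncomputable def bd {P : Type} : Ch P →ₗ[ZMod 2] Ch P := lext bdL

@[simp] lemma bd_sg {P : Type} (l : List P) : bd (sg l) = bdL l := by simp [bd]

lemma bd_cone {P : Type} (p : P) (z : Ch P) : bd (cone p z) = z + cone p (bd z) := by
  have : bd ∘ₗ cone p = LinearMap.id + cone p ∘ₗ bd := by
    apply lin_ext
    intro l
    simp [bdL]
  exact LinearMap.congr_fun this z

lemma bd_bdL {P : Type} (l : List P) : bd (bdL l) = 0 := by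
  induction l with
  | nil => simp [bdL]
  | cons p l ih => simp [bdL, bd_cone, ih, add_self']

lemma bd_bd {P : Type} (z : Ch P) : bd (bd z) = 0 := by
  have : bd ∘ₗ bd = (0 : Ch P →ₗ[ZMod 2] Ch P) := by
    apply lin_ext
    intro l
    simp [bd_bdL]
  exact LinearMap.congr_fun this z

noncomputable def push {P Q : Type} (f : P → Q) : Ch P →ₗ[ZMod 2] Ch Q :=
  lext (fun l => sg (l.map f))

@[simp] lemma push_sg {P Q : Type} (f : P → Q) (l : List P) :
    push f (sg l) = sg (l.map f) := by simp [push]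

lemma push_cone {P Q : Type} (f : P → Q) (p : P) (z : Ch P) :
    push f (cone p z) = cone (f p) (push f z) := by
  have : push f ∘ₗ cone p = cone (f p) ∘ₗ push f := by
    apply lin_ext
    intro l
    simp
  exact LinearMap.congr_fun this z

lemma push_bdL {P Q : Type} (f : P → Q) (l : List P) : push f (bdL l) = bdL (l.map f) := by
  induction l with
  | nil => simp [bdL]
  | cons p l ih => simp [bdL, push_cone, ih]

lemma bd_push {P Q : Type} (f : P → Q) (z : Ch P) : bd (push f z) = push f (bd z) := by
  have : bd ∘ₗ push f = push f ∘ₗ bd := by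
    apply lin_ext
    intro l
    simp [push_bdL]
  exact LinearMap.congr_fun this z

lemma push_push {P Q S : Type} (f : P → Q) (g : Q → S) (z : Ch P) :
    push g (push f z) = push (g ∘ f) z := by
  have : push g ∘ₗ push f = push (g ∘ f) := by
    apply lin_ext
    intro l
    simp
  exact LinearMap.congr_fun this z

lemma push_id {P : Type} (z : Ch P) : push (fun p => p) z = z := by
  have : push (fun p : P => p) = LinearMap.id := by
    apply lin_ext
    intro l
    simp
  exact LinearMap.congr_fun this z

noncomputable def prismL {P Q : Type} (f g : P → Q) : List P → Ch Q
  | [] => 0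
  | p :: l => sg (f p :: g p :: l.map g) + cone (f p) (prismL f g l)

noncomputable def prism {P Q : Type} (f g : P → Q) : Ch P →ₗ[ZMod 2] Ch Q := lext (prismL f g)

@[simp] lemma prism_sg {P Q : Type} (f g : P → Q) (l : List P) :
    prism f g (sg l) = prismL f g l := by simp [prism]

lemma prism_cone {P Q : Type} (f g : P → Q) (p : P) (z : Ch P) :
    prism f g (cone p z) = cone (f p) (cone (g p) (push g z)) + cone (f p) (prism f g z) := by
  have : prism f g ∘ₗ cone p
      = cone (f p) ∘ₗ cone (g p) ∘ₗ push g + cone (f p) ∘ₗ prism f g := by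
    apply lin_ext
    intro l
    simp [prismL]
  exact LinearMap.congr_fun this z

lemma prismL_eq {P Q : Type} (f g : P → Q) (l : List P) :
    bd (prismL f g l) + prism f g (bdL l) = sg (l.map f) + sg (l.map g) := by
  induction l with
  | nil => simp [bdL, prismL, add_self']
  | cons p l ih =>
    have h1 : bd (prismL f g l) = sg (l.map f) + sg (l.map g) + prism f g (bdL l) := by
      rw [← ih, add_assoc, add_self', add_zero]
    simp only [bdL, prismL, map_add, bd_sg, bd_cone, prism_sg, prism_cone, List.map_cons,
      cone_sg, push_bdL, h1]
    have a1 := add_self' (sg (f p :: l.map g))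
    have a2 := add_self' (cone (f p) (cone (g p) (bdL (l.map g))))
    have a3 := add_self' (prismL f g l)
    have a4 := add_self' (cone (f p) (prism f g (bdL l)))
    generalize cone (f p) (cone (g p) (bdL (l.map g))) = A at *
    generalize cone (f p) (prism f g (bdL l)) = B at *
    generalize prismL f g l = C at *
    generalize sg (f p :: l.map g) = D at *
    have : sg (g p :: List.map g l) + (D + A) + (C + (sg (f p :: List.map f l) + D + B))
        + (C + (A + B)) = sg (f p :: List.map f l) + sg (g p :: List.map g l)
          + (D + D) + (A + A) + (C + C) + (B + B) := by abel
    rw [this, a1, a2, a3, a4]; simp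

lemma prism_eq {P Q : Type} (f g : P → Q) (z : Ch P) :
    bd (prism f g z) + prism f g (bd z) = push f z + push g z := by
  have : bd ∘ₗ prism f g + prism f g ∘ₗ bd = push f + push g := by
    apply lin_ext
    intro l
    simp [prismL_eq]
  exact LinearMap.congr_fun this z

abbrev supp {P : Type} (s : Set (List P)) : Submodule (ZMod 2) (Ch P) :=
  Finsupp.supported (ZMod 2) (ZMod 2) s

lemma sg_mem {P : Type} {s : Set (List P)} {l : List P} (h : l ∈ s) : sg l ∈ supp s :=
  Finsupp.single_mem_supported _ _ h

lemma supp_map {P M : Type} [AddCommGroup M] [Module (ZMod 2) M]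
    (T : Ch P →ₗ[ZMod 2] M) (N : Submodule (ZMod 2) M) {s : Set (List P)}
    (h : ∀ l ∈ s, T (sg l) ∈ N) {z : Ch P} (hz : z ∈ supp s) : T z ∈ N := by
  rw [supp, Finsupp.supported_eq_span_single] at hz
  have : Submodule.span (ZMod 2) ((fun i => Finsupp.single i (1 : ZMod 2)) '' s)
      ≤ N.comap T := by
    rw [Submodule.span_le]
    rintro _ ⟨l, hl, rfl⟩
    exact h l hl
  exact this hz

lemma supp_eq {P M : Type} [AddCommGroup M] [Module (ZMod 2) M]
    (T T' : Ch P →ₗ[ZMod 2] M) {s : Set (List P)}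
    (h : ∀ l ∈ s, T (sg l) = T' (sg l)) {z : Ch P} (hz : z ∈ supp s) : T z = T' z := by
  have := supp_map (T - T') ⊥ (s := s) (by intro l hl; simp [h l hl]) hz
  simpa [sub_eq_zero] using this

lemma supp_mono {P : Type} {s t : Set (List P)} (h : s ⊆ t) {z : Ch P} (hz : z ∈ supp s) :
    z ∈ supp t := Finsupp.supported_mono h hz

lemma cone_mem {P : Type} {s t : Set (List P)} (p : P) (h : ∀ l ∈ s, p :: l ∈ t) {z : Ch P}
    (hz : z ∈ supp s) : cone p z ∈ supp t :=
  supp_map _ _ (fun l hl => by simpa using sg_mem (h l hl)) hz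

/-- terms of the boundary -/
lemma bdL_mem {P : Type} (l : List P) :
    bdL l ∈ supp {m | m.length + 1 = l.length ∧ m ⊆ l} := by
  induction l with
  | nil => simp [bdL]
  | cons p l ih =>
    refine Submodule.add_mem _ (sg_mem ?_) (cone_mem p ?_ ih)
    · simp
    · rintro m ⟨h1, h2⟩
      refine ⟨by simp [h1], ?_⟩
      exact List.cons_subset_cons p h2

lemma bdL_mem_nodup {P : Type} (l : List P) (hl : l.Nodup) :
    bdL l ∈ supp {m | ∃ a ∈ l, a ∉ m} := by
  induction l with
  | nil => simp [bdL]
  | cons p l ih =>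
    rw [List.nodup_cons] at hl
    refine Submodule.add_mem _ (sg_mem ⟨p, by simp, hl.1⟩) (cone_mem p ?_ (ih hl.2))
    rintro m ⟨a, h1, h2⟩
    refine ⟨a, by simp [h1], ?_⟩
    simp only [List.mem_cons, not_or]
    exact ⟨fun h => hl.1 (h ▸ h1), h2⟩

lemma prismL_mem {P Q : Type} (f g : P → Q) (l : List P) :
    prismL f g l ∈ supp {m | m.length = l.length + 1 ∧
      ∀ q ∈ m, ∃ p ∈ l, q = f p ∨ q = g p} := by
  induction l with
  | nil => simp [prismL]
  | cons p l ih =>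
    refine Submodule.add_mem _ (sg_mem ?_) (cone_mem _ ?_ ih)
    · refine ⟨by simp, ?_⟩
      intro q hq
      simp only [List.mem_cons, List.mem_map] at hq
      rcases hq with rfl | rfl | ⟨a, ha, rfl⟩
      · exact ⟨p, by simp⟩
      · exact ⟨p, by simp⟩
      · exact ⟨a, by simp [ha]⟩
    · rintro m ⟨h1, h2⟩
      refine ⟨by simp [h1], ?_⟩
      intro q hq
      simp only [List.mem_cons] at hq
      rcases hq with rfl | hq
      · exact ⟨p, by simp⟩
      · obtain ⟨a, ha, h⟩ := h2 q hq
        exact ⟨a, by simp [ha], h⟩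

lemma prismL_mem_degen {P Q : Type} (f g : P → Q) (l : List P) (h : ∀ p ∈ l, f p = g p) :
    prismL f g l ∈ supp {m | ¬ m.Nodup} := by
  induction l with
  | nil => simp [prismL]
  | cons p l ih =>
    refine Submodule.add_mem _ (sg_mem ?_)
      (cone_mem _ ?_ (ih (fun q hq => h q (List.mem_cons_of_mem _ hq))))
    · simp [h p (by simp)]
    · intro m hm
      simp only [mem_ofPred_eq] at hm ⊢
      exact fun h => hm (List.nodup_cons.1 h).2

/-- rainbow indicator -/
def rb {ι : Type} [DecidableEq ι] : Finset ι → List ι → ZMod 2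
  | F, [] => if F = ∅ then 1 else 0
  | F, a :: l => if a ∈ F then rb (F.erase a) l else 0

lemma rb_ne {ι : Type} [DecidableEq ι] (l : List ι) : ∀ (F : Finset ι), rb F l ≠ 0 →
    l.Nodup ∧ ∀ a, a ∈ l ↔ a ∈ F := by
  induction l with
  | nil => intro F h; simp [rb] at h; simp [h]
  | cons b l ih =>
    intro F h
    simp only [rb, ne_eq, ite_eq_right_iff, Classical.not_imp] at h
    obtain ⟨h1, h2⟩ := h
    obtain ⟨h3, h4⟩ := ih _ h2
    refine ⟨List.nodup_cons.2 ⟨?_, h3⟩, ?_⟩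
    · rw [h4]; simp
    · intro a
      rw [List.mem_cons, h4, Finset.mem_erase]
      by_cases hab : a = b
      · subst hab; simp [h1]
      · simp [hab]

lemma rb_cone {ι : Type} [DecidableEq ι] (F : Finset ι) (a : ι) (z : Ch ι) :
    lext (rb F) (cone a z) = if a ∈ F then lext (rb (F.erase a)) z else 0 := by
  split_ifs with h
  · have : lext (rb F) ∘ₗ cone a = lext (rb (F.erase a)) := by
      apply lin_ext; intro l; simp [rb, h]
    exact LinearMap.congr_fun this z
  · have : lext (rb F) ∘ₗ cone a = 0 := by
      apply lin_ext; intro l; simp [rb, h]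
    exact LinearMap.congr_fun this z

lemma rb_bdL {ι : Type} [DecidableEq ι] [Fintype ι] (l : List ι) : ∀ (F : Finset ι),
    lext (rb F) (bdL l) = ∑ i ∈ Fᶜ, rb (insert i F) l := by
  induction l with
  | nil => intro F; simp [bdL, rb]
  | cons a l ih =>
    intro F
    simp only [bdL, map_add, lext_sg, rb_cone, ih]
    by_cases ha : a ∈ F
    · simp only [ha, if_true, rb, Finset.mem_insert, or_true]
      have h1 : (F.erase a)ᶜ = insert a Fᶜ := by
        ext x; simp [or_iff_not_imp_left]
      rw [h1, Finset.sum_insert (by simpa using ha), Finset.insert_erase ha, ← add_assoc,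
        CharTwo.add_self_eq_zero, zero_add]
      apply Finset.sum_congr rfl
      intro i hi
      rw [Finset.erase_insert_of_ne]
      rintro rfl; simp [ha] at hi
    · simp only [ha, if_false, add_zero, rb, Finset.mem_insert, or_false]
      rw [Finset.sum_eq_single a]
      · simp [ha]
      · intro b _ hb; simp [Ne.symm hb]
      · intro h; simp [ha] at h

lemma rb_bd {ι : Type} [DecidableEq ι] [Fintype ι] (F : Finset ι) (z : Ch ι) :
    lext (rb F) (bd z) = ∑ i ∈ Fᶜ, lext (rb (insert i F)) z := by
  have : lext (rb F) ∘ₗ bd = ∑ i ∈ Fᶜ, lext (rb (insert i F)) := by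
    apply lin_ext; intro l; simp [rb_bdL]
  simpa using LinearMap.congr_fun this z

end Stmt8

namespace Stmt8

def fineSet {E : Type} [PseudoMetricSpace E] (C : Set E) (a : ℝ) (r : ℕ) : Set (List E) :=
  {l | l.length = r ∧ (∀ p ∈ l, p ∈ C) ∧ ∀ p ∈ l, ∀ q ∈ l, dist p q ≤ a}

lemma fine_mono {E : Type} [PseudoMetricSpace E] {C C' : Set E} {a a' : ℝ} {r : ℕ}
    (hC : C ⊆ C') (ha : a ≤ a') : fineSet C a r ⊆ fineSet C' a' r := by
  rintro l ⟨h1, h2, h3⟩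
  exact ⟨h1, fun p hp => hC (h2 p hp), fun p hp q hq => (h3 p hp q hq).trans ha⟩

lemma fill_dist {E : Type} [NormedAddCommGroup E] [NormedSpace ℝ E] (p p' q : E)
    (s s' : ℝ) (hs : 0 ≤ s) (hs1 : s ≤ 1) :
    dist (p + s • (q - p)) (p' + s' • (q - p')) ≤ dist p p' + |s - s'| * dist p' q := by
  have : p + s • (q - p) - (p' + s' • (q - p')) = (1 - s) • (p - p') + (s' - s) • (p' - q) := by
    module
  rw [dist_eq_norm, this]
  refine (norm_add_le _ _).trans ?_
  rw [norm_smul, norm_smul, ← dist_eq_norm p p', ← dist_eq_norm p' q, Real.norm_eq_abs,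
    Real.norm_eq_abs, abs_of_nonneg (by linarith : (0:ℝ) ≤ 1 - s), abs_sub_comm]
  have := dist_nonneg (x := p) (y := p')
  nlinarith

lemma fill {E : Type} [NormedAddCommGroup E] [NormedSpace ℝ E] {C : Set E} (hC : Convex ℝ C)
    {q : E} (hq : q ∈ C) {D : ℝ} (hD : ∀ p ∈ C, dist p q ≤ D) {a b : ℝ} (ha : 0 ≤ a) (hb : 0 < b)
    {r : ℕ} {z : Ch E} (hz : z ∈ supp (fineSet C a r)) (hz0 : bd z = 0) :
    ∃ w ∈ supp (fineSet C (a + b) (r + 1)), bd w = z := by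
  obtain ⟨N, hN⟩ := exists_nat_gt (D / b)
  have hD0 : 0 ≤ D := dist_nonneg.trans (hD q hq)
  have hN0 : (0 : ℝ) < N := lt_of_le_of_lt (by positivity) hN
  have hDb : (1 / N : ℝ) * D ≤ b := by
    rw [div_lt_iff₀ hb] at hN
    rw [div_mul_eq_mul_div, one_mul, div_le_iff₀ hN0]; linarith
  set f : ℕ → E → E := fun i p => p + ((i : ℝ) / N) • (q - p) with hf
  have hmem : ∀ i ≤ N, ∀ p ∈ C, f i p ∈ C := by
    intro i hi p hp
    have h1 : (i : ℝ) / N ≤ 1 := by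
      rw [div_le_one hN0]; exact_mod_cast hi
    exact hC.add_smul_sub_mem hp hq ⟨by positivity, h1⟩
  have hdist : ∀ i j : ℕ, i ≤ N → |(i : ℝ) / N - j / N| ≤ 1 / N → ∀ p ∈ C, ∀ p' ∈ C,
      dist p p' ≤ a → dist (f i p) (f j p') ≤ a + b := by
    intro i j hi hij p hp p' hp' h
    have h1 : (i : ℝ) / N ≤ 1 := by
      rw [div_le_one hN0]; exact_mod_cast hi
    refine (fill_dist p p' q _ _ (by positivity) h1).trans ?_
    have h2 := hD p' hp'
    have h3 : |(i : ℝ) / N - j / N| * dist p' q ≤ 1 / N * D :=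
      mul_le_mul hij h2 dist_nonneg (by positivity)
    linarith
  have key : ∀ i ≤ N, ∃ w ∈ supp (fineSet C (a + b) (r + 1)), bd w = z + push (f i) z := by
    intro i
    induction i with
    | zero =>
      intro _
      refine ⟨0, Submodule.zero_mem _, ?_⟩
      have : f 0 = fun p => p := by funext p; simp [hf]
      rw [this, push_id, add_self', map_zero]
    | succ i ih =>
      intro hi
      obtain ⟨w, hw, hwz⟩ := ih (by omega)
      refine ⟨w + prism (f i) (f (i + 1)) z, Submodule.add_mem _ hw ?_, ?_⟩
      · refine supp_map _ _ ?_ hz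
        rintro l ⟨h1, h2, h3⟩
        rw [prism_sg]
        refine supp_mono ?_ (prismL_mem _ _ l)
        rintro m ⟨g1, g2⟩
        refine ⟨by omega, ?_, ?_⟩
        · intro p hp
          obtain ⟨p', hp', h | h⟩ := g2 p hp
          · rw [h]; exact hmem i (by omega) _ (h2 _ hp')
          · rw [h]; exact hmem _ (by omega) _ (h2 _ hp')
        · intro p hp p' hp'
          have e1 : |(i : ℝ) / N - ((i + 1 : ℕ) : ℝ) / N| ≤ 1 / N := by
            have : (i : ℝ) / N - ((i + 1 : ℕ) : ℝ) / N = - (1 / N) := by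
              push_cast; ring
            rw [this, abs_neg, abs_of_nonneg (by positivity)]
          have e2 : |((i + 1 : ℕ) : ℝ) / N - (i : ℝ) / N| ≤ 1 / N := by
            rw [abs_sub_comm]; exact e1
          obtain ⟨u, hu, h | h⟩ := g2 p hp <;> obtain ⟨u', hu', h' | h'⟩ := g2 p' hp' <;>
            rw [h, h'] <;> refine hdist _ _ (by omega) ?_ _ (h2 _ hu) _ (h2 _ hu') (h3 _ hu _ hu')
          · simp
          · exact e1
          · exact e2
          · simp
      · have := prism_eq (f i) (f (i + 1)) z
        rw [hz0, map_zero, add_zero] at this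
        rw [map_add, hwz, this, add_assoc, ← add_assoc (push (f i) z), add_self', zero_add]
  obtain ⟨w, hw, hwz⟩ := key N le_rfl
  refine ⟨w + cone q (push (f N) z), Submodule.add_mem _ hw ?_, ?_⟩
  · have hfN : f N = fun _ => q := by
      funext p; simp [hf, div_self hN0.ne']
    rw [hfN]
    have : push (fun _ : E => q) z ∈ supp {l | l.length = r ∧ ∀ p ∈ l, p = q} := by
      refine supp_map _ _ ?_ hz
      rintro l ⟨h1, h2, h3⟩
      rw [push_sg]
      refine sg_mem ⟨by simpa using h1, ?_⟩
      intro p hp; simp at hp; exact hp.2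
    refine cone_mem q ?_ this
    rintro l ⟨h1, h2⟩
    have h3 : ∀ p ∈ q :: l, p = q := by
      intro p hp
      rcases List.mem_cons.1 hp with h | h
      · exact h
      · exact h2 p h
    refine ⟨by simp [h1], fun p hp => by rw [h3 p hp]; exact hq, fun p hp p' hp' => ?_⟩
    rw [h3 p hp, h3 p' hp', dist_self]; linarith
  · rw [map_add, hwz, bd_cone, bd_push, hz0, map_zero, map_zero, add_zero, add_assoc, add_self',
      add_zero]

/-- face of the standard simplex -/
def face {ι : Type} [Fintype ι] (F : Finset ι) : Set (ι → ℝ) :=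
  {s | (∀ j, 0 ≤ s j) ∧ ∑ j, s j = 1 ∧ ∀ j, j ∉ F → s j = 0}

lemma face_convex {ι : Type} [Fintype ι] (F : Finset ι) : Convex ℝ (face F) := by
  rintro s ⟨h1, h2, h3⟩ t ⟨g1, g2, g3⟩ a b ha hb hab
  refine ⟨fun j => ?_, ?_, fun j hj => ?_⟩
  · have := h1 j; have := g1 j
    simp only [Pi.add_apply, Pi.smul_apply, smul_eq_mul]; positivity
  · simp [Finset.sum_add_distrib, ← Finset.mul_sum, h2, g2, hab]
  · simp [h3 j hj, g3 j hj]

lemma face_le_one {ι : Type} [Fintype ι] {F : Finset ι} {s : ι → ℝ} (hs : s ∈ face F) (j : ι) :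
    s j ≤ 1 := by
  rw [← hs.2.1]; exact Finset.single_le_sum (fun i _ => hs.1 i) (Finset.mem_univ j)

lemma face_dist {ι : Type} [Fintype ι] {F : Finset ι} {s t : ι → ℝ} (hs : s ∈ face F)
    (ht : t ∈ face F) : dist s t ≤ 1 := by
  rw [dist_pi_le_iff (by norm_num)]
  intro j
  rw [Real.dist_eq, abs_le]
  have := hs.1 j; have := ht.1 j; have := face_le_one hs j; have := face_le_one ht j
  constructor <;> linarith

lemma face_mono {ι : Type} [Fintype ι] {F G : Finset ι} (h : F ⊆ G) : face F ⊆ face G :=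
  fun _ hs => ⟨hs.1, hs.2.1, fun j hj => hs.2.2 j (fun h' => hj (h h'))⟩

lemma subdiv {ι : Type} [Fintype ι] [DecidableEq ι] {b : ℝ} (hb : 0 < b) (r : ℕ) :
    ∃ S : List ι → Ch (ι → ℝ), S [] = sg [] ∧ ∀ l : List ι, l.length ≤ r →
      S l ∈ supp (fineSet (face l.toFinset) (l.length * b) l.length) ∧
      bd (S l) = lext S (bdL l) := by
  induction r with
  | zero =>
    refine ⟨fun _ => sg [], rfl, ?_⟩
    intro l hl
    have : l = [] := List.length_eq_zero_iff.1 (by omega)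
    subst this
    refine ⟨sg_mem ⟨rfl, by simp, by simp⟩, by simp [bdL]⟩
  | succ r ih =>
    obtain ⟨S, hS0, hS⟩ := ih
    have ex : ∀ l : List ι, l.length = r + 1 →
        ∃ w ∈ supp (fineSet (face l.toFinset) (l.length * b) l.length),
          bd w = lext S (bdL l) := by
      intro l hl
      obtain ⟨i, hi⟩ : ∃ i, i ∈ l := List.exists_mem_of_length_pos (by omega)
      have hq : (Pi.single i 1 : ι → ℝ) ∈ face l.toFinset := by
        refine ⟨fun j => ?_, by simp, fun j hj => ?_⟩
        · by_cases h : j = i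
          · subst h; simp
          · simp [h]
        · have : j ≠ i := by rintro rfl; exact hj (by simpa using hi)
          simp [this]
      have hz : lext S (bdL l) ∈ supp (fineSet (face l.toFinset) (r * b) r) := by
        refine supp_map _ _ ?_ (bdL_mem l)
        rintro m ⟨h1, h2⟩
        rw [lext_sg]
        have hm : m.length = r := by omega
        have := (hS m (by omega)).1
        rw [hm] at this
        refine supp_mono (fine_mono (face_mono ?_) le_rfl) this
        intro x hx; simp at hx ⊢; exact h2 hx
      have hz0 : bd (lext S (bdL l)) = 0 := by
        have : (bd ∘ₗ lext S) (bdL l) = (lext S ∘ₗ bd) (bdL l) := by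
          refine supp_eq _ _ ?_ (bdL_mem l)
          rintro m ⟨h1, h2⟩
          simpa using (hS m (by omega)).2
        have h2 : bd (lext S (bdL l)) = lext S (bd (bdL l)) := this
        rw [h2, bd_bdL, map_zero]
      obtain ⟨w, hw, hw2⟩ := fill (face_convex _) hq (fun p hp => face_dist hp hq)
        (by positivity : (0:ℝ) ≤ r * b) hb hz hz0
      refine ⟨w, ?_, hw2⟩
      have e : ((l.length : ℝ)) * b = r * b + b := by rw [hl]; push_cast; ring
      rw [e, hl]; exact hw
    choose! W hW hW2 using ex
    refine ⟨fun l => if l.length = r + 1 then W l else S l, by simp [hS0], ?_⟩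
    have hSS : ∀ l : List ι, l.length ≤ r + 1 →
        lext (fun l => if l.length = r + 1 then W l else S l) (bdL l) = lext S (bdL l) := by
      intro l hl
      refine supp_eq _ _ ?_ (bdL_mem l)
      rintro m ⟨h1, h2⟩
      have : m.length ≠ r + 1 := by omega
      simp [this]
    intro l hl
    rw [hSS l hl]
    by_cases h : l.length = r + 1
    · simp only [h, if_true]
      have := hW l h
      rw [h] at this
      exact ⟨this, hW2 l h⟩
    · simp only [h, if_false]
      exact hS l (by omega)

lemma sperner {ι : Type} [Fintype ι] [DecidableEq ι] (F : Finset ι) {b : ℝ} (hb : 0 < b) :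
    ∃ z : Ch (ι → ℝ), z ∈ supp (fineSet (face F) b F.card) ∧
      bd z ∈ supp {l | ∃ a ∈ F, ∀ p ∈ l, p ∈ face F ∧ p a = 0} ∧
      ∀ lab : (ι → ℝ) → ι, (∀ s ∈ face F, s (lab s) ≠ 0) →
        lext (rb F) (push lab z) = 1 := by
  obtain ⟨S, hS0, hS⟩ := subdiv (ι := ι) (b := b / (F.card + 1)) (by positivity) F.card
  have hFl : F.toList.toFinset = F := Finset.toList_toFinset F
  have hFn : F.toList.Nodup := F.nodup_toList
  have hlen : F.toList.length = F.card := Finset.length_toList F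
  refine ⟨S F.toList, ?_, ?_, ?_⟩
  · have := (hS F.toList (by omega)).1
    rw [hFl, hlen] at this
    refine supp_mono (fine_mono subset_rfl ?_) this
    rw [← mul_div_assoc, div_le_iff₀ (by positivity)]
    nlinarith
  · rw [(hS F.toList (by omega)).2]
    have h0 : bdL F.toList ∈ supp ({m | m.length + 1 = F.toList.length ∧ m ⊆ F.toList} ∩
        {m | ∃ a ∈ F.toList, a ∉ m}) := by
      have h1 := bdL_mem F.toList
      have h2 := bdL_mem_nodup F.toList hFn
      rw [supp, Finsupp.mem_supported] at *
      exact subset_inter h1 h2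
    refine supp_map _ _ ?_ h0
    rintro m ⟨⟨h1, h2⟩, a, ha, ham⟩
    rw [lext_sg]
    refine supp_mono ?_ (hS m (by omega)).1
    rintro l ⟨g1, g2, g3⟩
    refine ⟨a, by simpa using ha, fun p hp => ⟨?_, ?_⟩⟩
    · refine face_mono ?_ (g2 p hp)
      intro x hx; simpa using h2 (by simpa using hx)
    · exact (g2 p hp).2.2 a (by simpa using ham)
  · intro lab hlab
    have key : ∀ l : List ι, l.length ≤ F.card → l.Nodup → l ⊆ F.toList →
        lext (rb l.toFinset) (push lab (S l)) = 1 := by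
      intro l
      induction l with
      | nil => intro _ _ _; simp [hS0, rb]
      | cons i l ih =>
        intro hl hn hsub
        have hn' := List.nodup_cons.1 hn
        have hl' : l.length + 1 ≤ F.card := by simpa using hl
        have hsub' : l ⊆ F.toList := fun x hx => hsub (List.mem_cons_of_mem _ hx)
        have ih' := ih (by omega) hn'.2 hsub'
        -- labels of lists in S m
        have hlabS : ∀ m : List ι, m.length ≤ F.card → m ⊆ F.toList →
            push lab (S m) ∈ supp {L | ∀ x ∈ L, x ∈ m} := by
          intro m hm hmF
          refine supp_map _ _ ?_ (hS m hm).1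
          rintro L ⟨g1, g2, g3⟩
          rw [push_sg]
          refine sg_mem ?_
          intro x hx
          obtain ⟨p, hp, rfl⟩ := List.mem_map.1 hx
          by_contra hcon
          have hpf := g2 p hp
          refine hlab p (face_mono ?_ hpf) (hpf.2.2 _ (by simpa using hcon))
          intro y hy; simpa using hmF (by simpa using hy)
        have h1 := rb_bd l.toFinset (push lab (S (i :: l)))
        rw [Finset.sum_eq_single i] at h1
        · rw [List.toFinset_cons, ← h1, bd_push, (hS _ hl).2]
          simp only [bdL, map_add, lext_sg, ih']
          have h3 : (lext (rb l.toFinset) ∘ₗ push lab ∘ₗ lext S ∘ₗ cone i) (bdL l) =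
              (0 : Ch ι →ₗ[ZMod 2] ZMod 2) (bdL l) := by
            have h0 : bdL l ∈ supp ({m | m.length + 1 = l.length ∧ m ⊆ l} ∩
                {m | ∃ a ∈ l, a ∉ m}) := by
              have h1 := bdL_mem l
              have h2 := bdL_mem_nodup l hn'.2
              rw [supp, Finsupp.mem_supported] at *
              exact subset_inter h1 h2
            refine supp_eq _ _ ?_ h0
            rintro m ⟨⟨h1, h2⟩, a, ha, ham⟩
            simp only [LinearMap.comp_apply, cone_sg, lext_sg, LinearMap.zero_apply]
            have h4 := hlabS (i :: m) (by simp; omega) (by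
              intro x hx
              rcases List.mem_cons.1 hx with rfl | hx
              · exact hsub (by simp)
              · exact hsub' (h2 hx))
            have := supp_eq (lext (rb l.toFinset)) 0 (s := {L | ∀ x ∈ L, x ∈ i :: m}) (by
              intro L hL
              rw [lext_sg]
              by_contra hne
              have := (rb_ne L _ hne).2 a
              have ha2 : a ∈ i :: m := hL a (this.2 (by simpa using ha))
              rcases List.mem_cons.1 ha2 with rfl | h
              · exact hn'.1 ha
              · exact ham h) h4
            simpa using this
          simp only [LinearMap.comp_apply, LinearMap.zero_apply] at h3
          rw [h3, add_zero]
        · intro j hj hji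
          have := supp_eq (lext (rb (insert j l.toFinset))) 0 (s := {L | ∀ x ∈ L, x ∈ i :: l}) (by
              intro L hL
              rw [lext_sg]
              by_contra hne
              have := (rb_ne L _ hne).2 j
              have ha2 : j ∈ i :: l := hL j (this.2 (by simp))
              rcases List.mem_cons.1 ha2 with h | h
              · exact hji h
              · simp [h] at hj) (hlabS (i :: l) hl hsub)
          simpa using this
        · intro h; exfalso; apply h; simpa using hn'.1
    have := key F.toList (by omega) hFn (fun _ h => h)
    rwa [hFl] at this

end Stmt8

namespace Stmt8

section cocycle

variable {ι : Type} [Fintype ι] [DecidableEq ι] {Q : Type}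

noncomputable def phi (I : Finset ι) (lb : Q → ι) (g : ι → Q → ZMod 2) : List Q → ZMod 2
  | [] => 0
  | q :: l => ∑ i ∈ I, rb (I.erase i) ((q :: l).map lb) * g i q

lemma phi_degen (I : Finset ι) (lb : Q → ι) (g : ι → Q → ZMod 2) (l : List Q)
    (h : ¬ l.Nodup) : phi I lb g l = 0 := by
  cases l with
  | nil => rfl
  | cons q l =>
    rw [phi]
    apply Finset.sum_eq_zero
    intro i _
    have : rb (I.erase i) ((q :: l).map lb) = 0 := by
      by_contra hne
      exact h (List.Nodup.of_map _ (rb_ne _ _ hne).1)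
    rw [this, zero_mul]

def Good (k : ι) (T : Q → ι → ℝ) (lb : Q → ι) (g : ι → Q → ZMod 2) (N : Set Q) : Prop :=
  ∃ (J : Finset ι) (a : ι → ZMod 2), ∀ q ∈ N, lb q ∈ J ∧ (∀ j ∈ J, 0 < T q j) ∧ 0 < T q k ∧
    ∀ i, i ≠ k → (∀ j, j ≠ i → j ≠ k → j ∈ J) → g i q = a i

lemma good_cocycle (k : ι) (T : Q → ι → ℝ) (lb : Q → ι) (g : ι → Q → ZMod 2)
    (hlb : ∀ q, lb q ≠ k)
    (hsum : ∀ q, (∀ j, 0 < T q j) → ∑ i ∈ Finset.univ.erase k, g i q = 0)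
    (hI : ∀ i, ((Finset.univ.erase k).erase i).Nonempty)
    (N : Set Q) (hN : Good k T lb g N) (l : List Q) (hl : ∀ q ∈ l, q ∈ N) :
    lext (phi (Finset.univ.erase k) lb g) (bdL l) = 0 := by
  obtain ⟨J, a, hJ⟩ := hN
  set I : Finset ι := Finset.univ.erase k with hIdef
  have key : lext (phi I lb g) (bdL l)
      = (∑ i ∈ I, a i • (lext (rb (I.erase i)) ∘ₗ push lb)) (bdL l) := by
    refine supp_eq _ _ (s := {m | m.length + 1 = l.length ∧ m ⊆ l}) ?_ (bdL_mem l)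
    rintro m ⟨-, hm⟩
    simp only [lext_sg, LinearMap.coe_sum, Finset.sum_apply, LinearMap.smul_apply,
      LinearMap.comp_apply, push_sg, smul_eq_mul]
    cases m with
    | nil =>
      rw [phi, eq_comm]
      apply Finset.sum_eq_zero
      intro i _
      simp [rb, (hI i).ne_empty]
    | cons q m =>
      rw [phi]
      apply Finset.sum_congr rfl
      intro i hi
      rw [mul_comm]
      by_cases h0 : rb (I.erase i) ((q :: m).map lb) = 0
      · rw [h0]; simp
      · congr 1
        refine (hJ q (hl q (hm (by simp)))).2.2.2 i (by simpa [I] using hi) ?_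
        intro j hj hjk
        have : j ∈ (q :: m).map lb := ((rb_ne _ _ h0).2 j).2 (by simp [I, hj, hjk])
        obtain ⟨q', hq', rfl⟩ := List.mem_map.1 this
        exact (hJ q' (hl q' (hm hq'))).1
  rw [key]
  simp only [LinearMap.coe_sum, Finset.sum_apply, LinearMap.smul_apply,
      LinearMap.comp_apply, push_bdL, smul_eq_mul, rb_bdL]
  have h2 : ∀ i ∈ I, ∑ i' ∈ (I.erase i)ᶜ, rb (insert i' (I.erase i)) (l.map lb)
      = rb I (l.map lb) := by
    intro i hi
    rw [Finset.sum_eq_single i]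
    · rw [Finset.insert_erase hi]
    · intro b hb hbi
      have hbk : b = k := by
        by_contra hne
        simp [I, hbi, hne] at hb
      by_contra h0
      have := ((rb_ne _ _ h0).2 b).2 (by simp)
      obtain ⟨q', _, hq'⟩ := List.mem_map.1 this
      exact hlb q' (hq'.trans hbk)
    · intro h; simp at h
  rw [Finset.sum_congr rfl (fun i hi => by rw [h2 i hi]), ← Finset.sum_mul]
  by_cases h0 : rb I (l.map lb) = 0
  · simp [h0]
  · have hmem := (rb_ne _ _ h0).2
    have hJI : ∀ j, j ≠ k → j ∈ J := by
      intro j hj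
      obtain ⟨q', hq', rfl⟩ := List.mem_map.1 ((hmem j).2 (by simp [I, hj]))
      exact (hJ q' (hl q' hq')).1
    obtain ⟨i0, hi0⟩ := hI k
    obtain ⟨q, hq, -⟩ := List.mem_map.1 ((hmem i0).2 (by simp at hi0; simp [I, hi0]))
    have hqJ := hJ q (hl q hq)
    have : ∑ i ∈ I, a i = 0 := by
      rw [← hsum q]
      · apply Finset.sum_congr rfl
        intro i hi
        exact (hqJ.2.2.2 i (by simpa [I] using hi) (fun j _ hj => hJI j hj)).symm
      · intro j
        by_cases hj : j = k
        · rw [hj]; exact hqJ.2.2.1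
        · exact hqJ.2.1 j (hJI j hj)
    rw [this, zero_mul]

lemma good_nhds [TopologicalSpace Q] (k : ι) (T : Q → ι → ℝ) (hT : Continuous T)
    (lb : Q → ι) (g : ι → Q → ZMod 2)
    (hlb : ∀ q, lb q ≠ k) (hlb' : ∀ q j, j ≠ k → T q j ≤ T q (lb q))
    (hg : ∀ i a, IsOpen {q | (∀ j, j ≠ i → 0 < T q j) ∧ g i q = a})
    (q0 : Q) (h0 : 0 < T q0 k) (h1 : ∃ j, j ≠ k ∧ 0 < T q0 j) :
    ∃ U, IsOpen U ∧ q0 ∈ U ∧ Good k T lb g U := by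
  obtain ⟨j1, hj1, hj1'⟩ := h1
  have hM : 0 < T q0 (lb q0) := hj1'.trans_le (hlb' q0 j1 hj1)
  have hTj : ∀ j, Continuous fun q => T q j := fun j => (continuous_apply j).comp hT
  set J : Finset ι := Finset.univ.filter (fun j => j ≠ k ∧ T q0 j = T q0 (lb q0)) with hJ
  have e1 : ∀ j, j ∈ J → ∀ᶠ q in nhds q0, 0 < T q j := by
    intro j hj
    simp [hJ] at hj
    exact (hTj j).continuousAt.eventually (lt_mem_nhds (by show 0 < T q0 j; rw [hj.2]; exact hM))
  have e2 : ∀ j, j ∉ J → j ≠ k → ∀ᶠ q in nhds q0, T q j < T q (lb q0) := by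
    intro j hj hjk
    simp [hJ, hjk] at hj
    exact ((hTj j).continuousAt).eventually_lt (hTj _).continuousAt
      (lt_of_le_of_ne (hlb' q0 j hjk) hj)
  have e3 : ∀ᶠ q in nhds q0, 0 < T q k :=
    (hTj k).continuousAt.eventually (lt_mem_nhds h0)
  have e4 : ∀ i, i ≠ k → (∀ j, j ≠ i → j ≠ k → j ∈ J) → ∀ᶠ q in nhds q0, g i q = g i q0 := by
    intro i _ hi
    have : {q | (∀ j, j ≠ i → 0 < T q j) ∧ g i q = g i q0} ∈ nhds q0 := by
      apply (hg i (g i q0)).mem_nhds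
      refine ⟨fun j hj => ?_, rfl⟩
      by_cases hjk : j = k
      · rw [hjk]; exact h0
      · have := hi j hj hjk
        simp [hJ] at this
        rw [this.2]; exact hM
    filter_upwards [this] with q hq using hq.2
  have e : ∀ᶠ q in nhds q0, (∀ j, j ∈ J → 0 < T q j) ∧
      (∀ j, j ∉ J → j ≠ k → T q j < T q (lb q0)) ∧ 0 < T q k ∧
      (∀ i, i ≠ k → (∀ j, j ≠ i → j ≠ k → j ∈ J) → g i q = g i q0) := by
    refine Filter.Eventually.and ?_ (Filter.Eventually.and ?_ (Filter.Eventually.and e3 ?_))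
    · rw [Filter.eventually_all]
      intro j
      by_cases hj : j ∈ J
      · filter_upwards [e1 j hj] with q hq _ using hq
      · exact Filter.Eventually.of_forall (fun q h => absurd h hj)
    · rw [Filter.eventually_all]
      intro j
      by_cases hj : j ∉ J ∧ j ≠ k
      · filter_upwards [e2 j hj.1 hj.2] with q hq _ _ using hq
      · exact Filter.Eventually.of_forall (fun q h h' => absurd ⟨h, h'⟩ hj)
    · rw [Filter.eventually_all]
      intro i
      by_cases hi : i ≠ k ∧ (∀ j, j ≠ i → j ≠ k → j ∈ J)
      · filter_upwards [e4 i hi.1 hi.2] with q hq _ _ using hq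
      · exact Filter.Eventually.of_forall (fun q h h' => absurd ⟨h, h'⟩ hi)
  obtain ⟨U, hU, hUo, hqU⟩ := eventually_nhds_iff.1 e
  refine ⟨U, hUo, hqU, J, fun i => g i q0, fun q hq => ?_⟩
  obtain ⟨a1, a2, a3, a4⟩ := hU q hq
  refine ⟨?_, a1, a3, a4⟩
  by_contra hne
  have := a2 _ hne (hlb q)
  exact absurd (hlb' q (lb q0) (hlb q0)) (not_le.2 this)

lemma face_compact (F : Finset ι) : IsCompact (face F : Set (ι → ℝ)) := by
  have hc : IsClosed (face F : Set (ι → ℝ)) := by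
    have : (face F : Set (ι → ℝ)) = (⋂ j, {s | 0 ≤ s j}) ∩ ({s | ∑ j, s j = 1} ∩
        ⋂ j, ⋂ (_ : j ∉ F), {s | s j = 0}) := by
      ext s; simp [face]
    rw [this]
    refine (isClosed_iInter fun j => ?_).inter (IsClosed.inter ?_ ?_)
    · exact isClosed_le continuous_const (continuous_apply j)
    · exact isClosed_eq (continuous_finsetSum _ fun j _ => continuous_apply j) continuous_const
    · exact isClosed_iInter fun j => isClosed_iInter fun _ =>
        isClosed_eq (continuous_apply j) continuous_const
  refine (isCompact_univ_pi (fun _ : ι => isCompact_Icc (a := (0:ℝ)) (b := 1))).of_isClosed_subset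
    hc ?_
  intro s hs j _
  exact ⟨hs.1 j, by
    rw [← hs.2.1]; exact Finset.single_le_sum (fun i _ => hs.1 i) (Finset.mem_univ j)⟩

theorem no_homotopy [TopologicalSpace Q] (k c : ι) (hkc : k ≠ c) (F : Finset ι)
    (hF : ∀ j, j ∈ F ↔ j ≠ k ∧ j ≠ c) (hFne : F.Nonempty)
    (T : Q → ι → ℝ) (hT : Continuous T) (g : ι → Q → ZMod 2)
    (hg : ∀ i a, IsOpen {q | (∀ j, j ≠ i → 0 < T q j) ∧ g i q = a})
    (hsum : ∀ q, (∀ j, 0 < T q j) → ∑ i ∈ Finset.univ.erase k, g i q = 0)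
    (H : (ι → ℝ) × ℝ → Q) (hH : Continuous H)
    (hpos : ∀ s ∈ face F, ∀ r ∈ Icc (0:ℝ) 1, 0 < T (H (s, r)) k ∧ ∃ j, j ≠ k ∧ 0 < T (H (s, r)) j)
    (hbd : ∀ s ∈ face F, ∀ r ∈ Icc (0:ℝ) 1, (∃ a ∈ F, s a = 0) → H (s, r) = H (s, 0))
    (ε : ℝ) (hε : 0 < ε)
    (hT0 : ∀ s ∈ face F, ∀ j, j ≠ k → T (H (s, 0)) j = ε * s j)
    (hT1 : ∀ s ∈ face F, ∀ j, j ≠ k → T (H (s, 1)) j = ε * s j)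
    (hg0 : ∀ s ∈ face F, (∀ a ∈ F, 0 < s a) → g c (H (s, 0)) = 1)
    (hg1 : ∀ s ∈ face F, (∀ a ∈ F, 0 < s a) → g c (H (s, 1)) = 0) : False := by
  set I : Finset ι := Finset.univ.erase k with hIdef
  have hIne : ∀ i, (I.erase i).Nonempty := by
    intro i
    obtain ⟨j, hj⟩ := hFne
    rw [hF] at hj
    by_cases hi : j = i
    · exact ⟨c, by simp [I, hkc.symm, ← hi, hj.2.symm]⟩
    · exact ⟨j, by simp [I, hi, hj.1]⟩
  have hIc : I.erase c = F := by
    ext j; simp [I, hF, and_comm]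
  have hlab : ∀ t : ι → ℝ, ∃ j, j ≠ k ∧ ∀ i, i ≠ k → t i ≤ t j := by
    intro t
    obtain ⟨j, hj, hj'⟩ := Finset.exists_max_image I t ⟨c, by simp [I, hkc.symm]⟩
    exact ⟨j, by simpa [I] using hj, fun i hi => hj' i (by simp [I, hi])⟩
  choose lab hlab1 hlab2 using hlab
  set lb : Q → ι := fun q => lab (T q) with hlb
  have hK : IsCompact ((face F : Set (ι → ℝ)) ×ˢ Icc (0:ℝ) 1) :=
    (face_compact F).prod isCompact_Icc
  obtain ⟨δ, hδ, hLeb⟩ := lebesgue_number_lemma_of_metric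
    (c := fun U : {U : Set Q // IsOpen U ∧ Good k T lb g U} => H ⁻¹' U.1) hK
    (fun U => U.2.1.preimage hH) (by
      rintro ⟨s, r⟩ ⟨hs, hr⟩
      obtain ⟨U, h1, h2, h3⟩ := good_nhds k T hT lb g (fun q => hlab1 _) (fun q => hlab2 _) hg
        (H (s, r)) (hpos s hs r hr).1 (hpos s hs r hr).2
      exact mem_iUnion.2 ⟨⟨U, h1, h3⟩, h2⟩)
  obtain ⟨z, hz1, hz2, hz3⟩ := sperner F (b := δ / 2) (by linarith)
  let Nr : ℝ → ZMod 2 := fun r => lext (phi I lb g) (push (fun s => H (s, r)) z)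
  have step : ∀ r ∈ Icc (0:ℝ) 1, ∀ r' ∈ Icc (0:ℝ) 1, dist r' r < δ → Nr r = Nr r' := by
    intro r hr r' hr' hd
    have h := congrArg (lext (phi I lb g)) (prism_eq (fun s => H (s, r)) (fun s => H (s, r')) z)
    simp only [map_add] at h
    have h1 : lext (phi I lb g) (bd (prism (fun s => H (s, r)) (fun s => H (s, r')) z)) = 0 := by
      have := supp_map ((lext (phi I lb g)) ∘ₗ bd ∘ₗ
        (prism (fun s => H (s, r)) (fun s => H (s, r')))) ⊥ ?_ hz1
      · simpa using this
      rintro l ⟨-, hl2, hl3⟩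
      simp only [LinearMap.comp_apply, prism_sg]
      cases l with
      | nil => simp [prismL]
      | cons p l =>
        obtain ⟨⟨U, hUo, hUg⟩, hU⟩ := hLeb (p, r) ⟨hl2 p (by simp), hr⟩
        have := supp_map ((lext (phi I lb g)) ∘ₗ bd) ⊥ ?_
          (prismL_mem (fun s => H (s, r)) (fun s => H (s, r')) (p :: l))
        · exact this
        rintro m ⟨-, hm⟩
        simp only [LinearMap.comp_apply, bd_sg, Submodule.mem_bot]
        apply good_cocycle k T lb g (fun q => hlab1 _) hsum hIne U hUg
        intro q hq
        obtain ⟨p', hp', hq'⟩ := hm q hq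
        have hdist : dist p' p < δ := by
          have := hl3 p' hp' p (by simp)
          linarith
        rcases hq' with rfl | rfl
        · exact hU (by simp [Prod.dist_eq, hdist, hδ])
        · exact hU (by simp only [Metric.mem_ball, Prod.dist_eq]; exact max_lt hdist hd)
    have h2 : lext (phi I lb g) (prism (fun s => H (s, r)) (fun s => H (s, r')) (bd z)) = 0 := by
      have := supp_map ((lext (phi I lb g)) ∘ₗ
        (prism (fun s => H (s, r)) (fun s => H (s, r')))) ⊥ ?_ hz2
      · simpa using this
      rintro l ⟨a, ha, hl⟩
      simp only [LinearMap.comp_apply, prism_sg]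
      have := supp_map (lext (phi I lb g)) ⊥ ?_
        (prismL_mem_degen (fun s => H (s, r)) (fun s => H (s, r')) l ?_)
      · exact this
      · intro m hm
        simp only [lext_sg, Submodule.mem_bot]
        exact phi_degen _ _ _ _ hm
      · intro p hp
        obtain ⟨hp1, hp2⟩ := hl p hp
        show H (p, r) = H (p, r')
        rw [hbd p hp1 r hr ⟨a, ha, hp2⟩, hbd p hp1 r' hr' ⟨a, ha, hp2⟩]
    rw [h1, h2, zero_add] at h
    exact (CharTwo.add_eq_zero.1 h.symm)
  have hN01 : Nr 0 = Nr 1 := by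
    obtain ⟨M, hM⟩ := exists_nat_one_div_lt hδ
    have hM0 : (0:ℝ) < M + 1 := by positivity
    have : ∀ i : ℕ, i ≤ M + 1 → Nr 0 = Nr (i / (M + 1)) := by
      intro i
      induction i with
      | zero => intro _; simp
      | succ i ih =>
        intro hi
        rw [ih (by omega)]
        have hi' : (i : ℝ) + 1 ≤ M + 1 := by exact_mod_cast hi
        apply step
        · exact ⟨by positivity, by rw [div_le_one hM0]; linarith⟩
        · exact ⟨by positivity, by rw [div_le_one hM0]; push_cast; linarith⟩
        · rw [Real.dist_eq, ← sub_div]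
          push_cast
          rw [add_sub_cancel_left, abs_of_pos (by positivity)]
          exact hM
    have h := this (M + 1) le_rfl
    rw [h]
    congr 1
    push_cast
    field_simp
  -- evaluation at the ends
  have hend : ∀ (r : ℝ) (a : ZMod 2), r ∈ Icc (0:ℝ) 1 →
      (∀ s ∈ face F, ∀ j, j ≠ k → T (H (s, r)) j = ε * s j) →
      (∀ s ∈ face F, (∀ a ∈ F, 0 < s a) → g c (H (s, r)) = a) → Nr r = a := by
    intro r a hr hTr hgr
    have hlabne : ∀ s ∈ face F, s (lb (H (s, r))) ≠ 0 := by
      intro s hs h0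
      obtain ⟨j, hjF, hj⟩ : ∃ j ∈ F, 0 < s j := by
        by_contra! hcon
        have : ∑ j, s j = 0 := Finset.sum_eq_zero (fun j _ => by
          by_cases hj : j ∈ F
          · exact le_antisymm (hcon j hj) (hs.1 j)
          · exact hs.2.2 j hj)
        rw [hs.2.1] at this
        exact one_ne_zero this
      have := hlab2 (T (H (s, r))) j ((hF j).1 hjF).1
      rw [hTr s hs j ((hF j).1 hjF).1, hTr s hs _ (hlab1 _)] at this
      have h0' : s (lab (T (H (s, r)))) = 0 := h0
      rw [h0'] at this
      nlinarith [mul_pos hε hj]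
    have h1 := hz3 (fun s => lb (H (s, r))) hlabne
    have h2 : Nr r = (a • (lext (rb F) ∘ₗ push (fun s => lb (H (s, r))))) z := by
      refine supp_eq ((lext (phi I lb g)) ∘ₗ push (fun s => H (s, r))) _ ?_ hz1
      rintro l ⟨-, hl2, hl3⟩
      simp only [LinearMap.comp_apply, push_sg, lext_sg, LinearMap.smul_apply, smul_eq_mul]
      cases l with
      | nil => simp [phi, rb, hFne.ne_empty]
      | cons p l =>
        rw [List.map_cons, phi, Finset.sum_eq_single c]
        · rw [hIc, mul_comm]
          have : (H (p, r) :: l.map (fun s => H (s, r))).map lb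
              = (p :: l).map (fun s => lb (H (s, r))) := by simp
          rw [this]
          by_cases h0 : rb F ((p :: l).map (fun s => lb (H (s, r)))) = 0
          · rw [h0]; simp
          · have hp : p ∈ face F := hl2 p (by simp)
            rw [hgr p hp]
            intro b hb
            obtain ⟨⟨U, hUo, J, a', hJ⟩, hU⟩ := hLeb (p, r) ⟨hp, hr⟩
            obtain ⟨p', hp', hpb⟩ := List.mem_map.1 (((rb_ne _ _ h0).2 b).2 hb)
            have hp'U : H (p', r) ∈ U := hU (by
              have := hl3 p' hp' p (by simp)
              simp only [Metric.mem_ball, Prod.dist_eq, dist_self]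
              exact max_lt (by linarith) hδ)
            have hbJ : b ∈ J := hpb ▸ (hJ _ hp'U).1
            have hpU : H (p, r) ∈ U := hU (by simp [hδ])
            have := (hJ _ hpU).2.1 b hbJ
            rw [hTr p hp b ((hF b).1 hb).1] at this
            exact pos_of_mul_pos_right this hε.le
        · intro i hi hic
          have : rb (I.erase i) ((H (p, r) :: l.map (fun s => H (s, r))).map lb) = 0 := by
            by_contra h0
            have := ((rb_ne _ _ h0).2 c).2 (by simp [I, hkc.symm, hic.symm])
            rw [← List.map_cons (f := fun s => H (s, r)), List.map_map] at this
            obtain ⟨p', hp', hpc⟩ := List.mem_map.1 this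
            have hp'F := hl2 p' hp'
            apply hlabne p' hp'F
            have hpc' : lb (H (p', r)) = c := hpc
            rw [hpc']
            exact hp'F.2.2 c (by simp [hF])
          rw [this, zero_mul]
        · intro h; simp [I, hkc.symm] at h
    rw [h2, LinearMap.smul_apply, LinearMap.comp_apply, h1]
    simp
  rw [hend 0 1 (by simp) hT0 hg0, hend 1 0 (by simp) hT1 hg1] at hN01
  exact one_ne_zero hN01

end cocycle

end Stmt8

namespace Stmt8

lemma compact_lower {P : Type} [TopologicalSpace P] {S : Set P} (hS : IsCompact S) {f : P → ℝ}
    (hf : ContinuousOn f S) (h0 : ∀ u ∈ S, 0 < f u) : ∃ m, 0 < m ∧ ∀ u ∈ S, m ≤ f u := by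
  rcases S.eq_empty_or_nonempty with rfl | hne
  · exact ⟨1, one_pos, by simp⟩
  · obtain ⟨u, hu, hm⟩ := hS.exists_isMinOn hne hf
    exact ⟨f u, h0 u hu, fun v hv => hm hv⟩

theorem extend_nonzero {A E : Type} [NormedAddCommGroup A] [NormedSpace ℝ A]
    [FiniteDimensional ℝ A] [NormedAddCommGroup E] [NormedSpace ℝ E] [FiniteDimensional ℝ E]
    (hdim : Module.finrank ℝ A < Module.finrank ℝ E) (S : Set A) (hS : IsCompact S)
    (h : A → E) (hc : ContinuousOn h S) (h0 : ∀ u ∈ S, h u ≠ 0) (ρ : ℝ) (hρ : 0 < ρ)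
    (hb : ∀ u ∈ S, ‖h u‖ < ρ) :
    ∃ G : A → E, Continuous G ∧ (∀ u ∈ S, G u = h u) ∧ (∀ u, G u ≠ 0) ∧ ∀ u, ‖G u‖ < ρ := by
  obtain ⟨m1, hm1, hm1'⟩ := compact_lower hS hc.norm (fun u hu => norm_pos_iff.2 (h0 u hu))
  obtain ⟨m2, hm2, hm2'⟩ := compact_lower hS (f := fun u => ρ - ‖h u‖)
    (continuousOn_const.sub hc.norm) (fun u hu => by linarith [hb u hu])
  set ε : ℝ := min (m1 / 4) (min (m2 / 4) (ρ / 4)) with hεd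
  have hε : 0 < ε := by positivity
  have hε1 : 4 * ε ≤ m1 := by
    have : ε ≤ m1 / 4 := min_le_left _ _
    linarith
  have hε2 : 4 * ε ≤ m2 := by
    have : ε ≤ m2 / 4 := (min_le_right _ _).trans (min_le_left _ _)
    linarith
  have hε3 : 4 * ε ≤ ρ := by
    have : ε ≤ ρ / 4 := (min_le_right _ _).trans (min_le_right _ _)
    linarith
  have hr : 0 < ρ - 3 * ε := by linarith
  have : TietzeExtension.{0, 0} (Metric.closedBall (0 : E) (ρ - 3 * ε)) :=
    Metric.instTietzeExtensionClosedBall ℝ (0 : E) hr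
  obtain ⟨G0, hG0b, hG0⟩ := ContinuousMap.exists_forall_mem_restrict_eq hS.isClosed
    (⟨fun u : S => h u, hc.comp_continuous continuous_subtype_val (fun u => u.2)⟩ : C(S, E))
    (t := Metric.closedBall (0 : E) (ρ - 3 * ε)) (by
      intro u
      have := hm2' u u.2
      rw [mem_closedBall_zero_iff]
      show ‖h u‖ ≤ _
      linarith)
  have hG0S : ∀ u ∈ S, G0 u = h u := by
    intro u hu
    have := congrArg (fun f : C(S, E) => f ⟨u, hu⟩) hG0
    exact this
  obtain ⟨G1, hG1⟩ := exists_contMDiffMap_forall_mem_convex_of_local_const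
    (modelWithCornersSelf ℝ A) (n := 1) (t := fun u => Metric.ball (G0 u) ε)
    (fun u => convex_ball _ _) (fun u => ⟨G0 u, by
      have : ∀ᶠ v in nhds u, dist (G0 v) (G0 u) < ε :=
        G0.continuous.continuousAt.eventually (Metric.ball_mem_nhds _ hε)
      filter_upwards [this] with v hv
      rw [Metric.mem_ball, dist_comm]; exact hv⟩)
  have hG1d : ContDiff ℝ 1 G1 := G1.contMDiff.contDiff
  obtain ⟨q, hq, hqn⟩ := (hG1d.dense_compl_range_of_finrank_lt_finrank hdim).exists_dist_lt 0 hε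
  rw [dist_zero_left] at hqn
  let G2 : A → E := fun u => G1 u - q
  have hG2c : Continuous G2 := hG1d.continuous.sub continuous_const
  have hG2 : ∀ u, ‖G2 u - G0 u‖ ≤ 2 * ε := by
    intro u
    have h1 := hG1 u
    rw [Metric.mem_ball, dist_eq_norm] at h1
    have : G2 u - G0 u = (G1 u - G0 u) - q := by simp only [G2]; abel
    rw [this]
    linarith [norm_sub_le (G1 u - G0 u) q]
  have hG2n : ∀ u, G2 u ≠ 0 := fun u hu => hq ⟨u, sub_eq_zero.1 hu⟩
  let χ : A → ℝ := fun u => min 1 (max 0 (‖G0 u‖ / ε - 3))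
  have hχc : Continuous χ :=
    continuous_const.min (continuous_const.max ((G0.continuous.norm.div_const _).sub
      continuous_const))
  have hχ0 : ∀ u, 0 ≤ χ u := fun u => le_min zero_le_one (le_max_left _ _)
  have hχ1 : ∀ u, χ u ≤ 1 := fun u => min_le_left _ _
  have hdist : ∀ u, ‖(G2 u + χ u • (G0 u - G2 u)) - G0 u‖ ≤ 2 * ε := by
    intro u
    have : (G2 u + χ u • (G0 u - G2 u)) - G0 u = (1 - χ u) • (G2 u - G0 u) := by
      module
    rw [this, norm_smul, Real.norm_of_nonneg (by linarith [hχ1 u])]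
    calc (1 - χ u) * ‖G2 u - G0 u‖ ≤ 1 * (2 * ε) :=
          mul_le_mul (by linarith [hχ0 u]) (hG2 u) (norm_nonneg _) zero_le_one
      _ = _ := one_mul _
  refine ⟨fun u => G2 u + χ u • (G0 u - G2 u),
    hG2c.add (hχc.smul (G0.continuous.sub hG2c)), ?_, ?_, ?_⟩
  · intro u hu
    have : χ u = 1 := by
      apply min_eq_left
      apply le_max_of_le_right
      have h4 : 4 ≤ ‖G0 u‖ / ε := by
        rw [le_div_iff₀ hε, hG0S u hu]
        exact hε1.trans (hm1' u hu)
      linarith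
    simp [this, hG0S u hu]
  · intro u hu
    by_cases h3 : ‖G0 u‖ ≤ 3 * ε
    · have : χ u = 0 := by
        have : ‖G0 u‖ / ε ≤ 3 := by rw [div_le_iff₀ hε]; exact h3
        simp only [χ]
        rw [max_eq_left (by linarith)]
        simp
      have hu' : G2 u + χ u • (G0 u - G2 u) = 0 := hu
      rw [this, zero_smul, add_zero] at hu'
      exact hG2n u hu'
    · have := hdist u
      have hu' : G2 u + χ u • (G0 u - G2 u) = 0 := hu
      rw [hu', zero_sub, norm_neg] at this
      linarith
  · intro u
    have h1 := hdist u
    have h2 := hG0b u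
    rw [mem_closedBall_zero_iff] at h2
    have h3 := norm_le_norm_add_norm_sub' (G2 u + χ u • (G0 u - G2 u)) (G0 u)
    show ‖G2 u + χ u • (G0 u - G2 u)‖ < ρ
    linarith

end Stmt8

namespace Stmt8

open PCG

section real

variable {n : ℕ} {V : Type} (Γ : PCG n V)

def pt (u : V) (t : ↥(stdSimplex ℝ (Fin (n + 1)))) : Γ.RealSp Set.univ :=
  Quot.mk _ ⟨⟨u, trivial⟩, t⟩

lemma pt_inv (c : Fin (n + 1)) (u : V) (t : ↥(stdSimplex ℝ (Fin (n + 1))))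
    (h : (t : Fin (n + 1) → ℝ) c = 0) : pt Γ u t = pt Γ (Γ.inv c u) t :=
  Quot.sound ⟨c, rfl, rfl, h⟩

lemma pt_reach (B : Set (Fin (n + 1))) (u w : V) (t : ↥(stdSimplex ℝ (Fin (n + 1))))
    (h : Γ.reach B u w) (ht : ∀ j ∈ B, (t : Fin (n + 1) → ℝ) j = 0) : pt Γ u t = pt Γ w t := by
  induction h with
  | refl => rfl
  | tail _ hs ih =>
    obtain ⟨c, hc, rfl⟩ := hs
    rw [ih, ← pt_inv Γ c _ t (ht c hc)]

lemma pt_surj (q : Γ.RealSp Set.univ) : ∃ u t, q = pt Γ u t := by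
  obtain ⟨⟨⟨u, _⟩, t⟩, rfl⟩ := Quot.exists_rep q
  exact ⟨u, t, rfl⟩

lemma pt_cont (u : V) : Continuous (pt Γ u) :=
  continuous_quot_mk.comp continuous_sigmaMk

def coT : Γ.RealSp Set.univ → Fin (n + 1) → ℝ :=
  Quot.lift (fun a => (a.2 : Fin (n + 1) → ℝ)) (by
    rintro a b ⟨c, _, h, _⟩
    rw [h])

lemma coT_pt (u : V) (t : ↥(stdSimplex ℝ (Fin (n + 1)))) : coT Γ (pt Γ u t) = t := rfl

lemma coT_cont : Continuous (coT Γ) :=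
  continuous_quot_lift _ (continuous_sigma fun _ => continuous_subtype_val)

open Classical in
noncomputable def gf (γ : V → Fin (n + 1) → ZMod 2) (hγ : ∀ i u, γ (Γ.inv i u) i = γ u i)
    (i : Fin (n + 1)) : Γ.RealSp Set.univ → ZMod 2 :=
  Quot.lift (fun a => if ∀ j, j ≠ i → 0 < (a.2 : Fin (n + 1) → ℝ) j then γ a.1 i else 0) (by
    rintro a b ⟨c, h1, h2, h3⟩
    simp only [h2]
    split_ifs with h
    · have hc : c = i := by
        by_contra hne
        exact absurd (h c hne) (by rw [h3]; exact lt_irrefl _)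
      rw [h1, hc, hγ]
    · rfl)

lemma gf_pt (γ : V → Fin (n + 1) → ZMod 2) (hγ : ∀ i u, γ (Γ.inv i u) i = γ u i)
    (i : Fin (n + 1)) (u : V) (t : ↥(stdSimplex ℝ (Fin (n + 1))))
    (h : ∀ j, j ≠ i → 0 < (t : Fin (n + 1) → ℝ) j) : gf Γ γ hγ i (pt Γ u t) = γ u i := by
  show (if _ then _ else _) = _
  exact if_pos h

lemma gf_open (γ : V → Fin (n + 1) → ZMod 2) (hγ : ∀ i u, γ (Γ.inv i u) i = γ u i)
    (i : Fin (n + 1)) (a : ZMod 2) :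
    IsOpen {q | (∀ j, j ≠ i → 0 < coT Γ q j) ∧ gf Γ γ hγ i q = a} := by
  rw [← isQuotientMap_quot_mk.isOpen_preimage, isOpen_sigma_iff]
  rintro ⟨u, _⟩
  have hop : IsOpen {t : ↥(stdSimplex ℝ (Fin (n + 1))) |
      ∀ j, j ≠ i → 0 < (t : Fin (n + 1) → ℝ) j} := by
    simp only [Set.ofPred_forall]
    exact isOpen_iInter_of_finite fun j => isOpen_iInter_of_finite fun _ =>
      isOpen_lt continuous_const ((continuous_apply j).comp continuous_subtype_val)
  by_cases h : γ u i = a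
  · convert hop using 1
    ext t
    constructor
    · intro ht; exact ht.1
    · intro ht
      exact ⟨ht, (gf_pt Γ γ hγ i u t ht).trans h⟩
  · convert isOpen_empty using 1
    ext t
    simp only [Set.mem_empty_iff_false, iff_false]
    intro ht
    exact h ((gf_pt Γ γ hγ i u t ht.1).symm.trans ht.2)

lemma chart (X : Type) [TopologicalSpace X] (hX : IsClosedManifoldN n X) (hgem : Γ.IsGemOf X)
    (v : Γ.RealSp Set.univ) :
    ∃ κ : EuclideanSpace ℝ (Fin n) → Γ.RealSp Set.univ, Topology.IsOpenEmbedding κ ∧ κ 0 = v := by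
  obtain ⟨φ⟩ := hgem
  obtain ⟨_, _, hc⟩ := hX
  obtain ⟨U, hvU, hU, ⟨e⟩⟩ := hc (φ v)
  refine ⟨fun p => φ.symm (e.symm (p + e ⟨φ v, hvU⟩) : U), ?_, ?_⟩
  · exact φ.symm.isOpenEmbedding.comp (hU.isOpenEmbedding_subtypeVal.comp
      (e.symm.isOpenEmbedding.comp (Homeomorph.addRight (e ⟨φ v, hvU⟩)).isOpenEmbedding))
  · simp

open Classical in
noncomputable def Pt (u : V) (t : Fin (n + 1) → ℝ) : Γ.RealSp Set.univ :=
  if h : t ∈ stdSimplex ℝ (Fin (n + 1)) then pt Γ u ⟨t, h⟩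
  else pt Γ u ⟨Pi.single 0 1, single_mem_stdSimplex ℝ 0⟩

lemma Pt_eq (u : V) (t : Fin (n + 1) → ℝ) (h : t ∈ stdSimplex ℝ (Fin (n + 1))) :
    Pt Γ u t = pt Γ u ⟨t, h⟩ := dif_pos h

lemma Pt_cont (u : V) : ContinuousOn (Pt Γ u) (stdSimplex ℝ (Fin (n + 1))) := by
  rw [continuousOn_iff_continuous_domRestrict]
  convert pt_cont Γ u using 1
  ext t
  exact Pt_eq Γ u t t.2

end real

end Stmt8

namespace Stmt8

open PCG

theorem no_gamma {n : ℕ} {V : Type} [Fintype V] (hn : 3 ≤ n)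
    (X : Type) [TopologicalSpace X] (hX : IsClosedManifoldN n X)
    (Γ : PCG n V) (hgem : Γ.IsGemOf X) (c k : Fin (n + 1)) (hkc : k ≠ c) (x y : V)
    (hR : ∀ i, i ≠ c → Γ.sameCycle c i x y)
    (γ : V → Fin (n + 1) → ZMod 2) (hγ : ∀ i u, γ (Γ.inv i u) i = γ u i)
    (hsum : ∀ v, ∑ i ∈ Finset.univ.erase k, γ v i = 0)
    (hx : γ x c = 1) (hy : γ y c = 0) : False := by
  classical
  set F : Finset (Fin (n + 1)) := (Finset.univ.erase k).erase c with hFd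
  have hF : ∀ j, j ∈ F ↔ j ≠ k ∧ j ≠ c := by intro j; simp [F, and_comm]
  have hFcard : F.card = n - 1 := by
    rw [hFd, Finset.card_erase_of_mem (by simp [hkc.symm]), Finset.card_erase_of_mem (by simp)]
    simp
  have hFne : F.Nonempty := by rw [← Finset.card_pos]; omega
  obtain ⟨i0, hi0⟩ := hFne
  have hT2 : T2Space (Γ.RealSp Set.univ) := by
    obtain ⟨φ⟩ := hgem
    obtain ⟨h2, _, _⟩ := hX
    exact φ.symm.t2Space
  let dk : ↥(stdSimplex ℝ (Fin (n + 1))) := ⟨Pi.single k 1, single_mem_stdSimplex ℝ k⟩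
  set v := pt Γ x dk with hv
  have hvy : pt Γ y dk = v := by
    refine (pt_reach Γ {c, i0} x y dk (hR i0 ((hF i0).1 hi0).2) ?_).symm
    rintro j (rfl | rfl)
    · simp [dk, hkc.symm]
    · simp [dk, ((hF _).1 hi0).1]
  obtain ⟨κ, hκ, hκ0⟩ := chart Γ X hX hgem v
  -- the neighbourhood O
  let bad : Set (Γ.RealSp Set.univ) := Set.range (fun u => pt Γ u dk) \ {v}
  have hbadf : bad.Finite := (Set.finite_range _).subset Set.sdiff_subset
  let O : Set (Γ.RealSp Set.univ) := {q | 0 < coT Γ q k} ∩ badᶜ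
  have hO : IsOpen O :=
    (isOpen_lt continuous_const ((continuous_apply k).comp (coT_cont Γ))).inter
      hbadf.isClosed.isOpen_compl
  have hvO : v ∈ O := ⟨by simp [hv, coT_pt, dk], by simp [bad]⟩
  obtain ⟨ρ, hρ, hρO⟩ := Metric.isOpen_iff.1 (hO.preimage hκ.continuous) 0
    (by rw [Set.mem_preimage, hκ0]; exact hvO)
  have hW : IsOpen (κ '' Metric.ball 0 ρ) := hκ.isOpenMap _ Metric.isOpen_ball
  have hvW : v ∈ κ '' Metric.ball 0 ρ := ⟨0, by simpa using hρ, hκ0⟩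
  -- choice of ε
  have hnear : ∀ u, pt Γ u dk = v → ∃ ε0 > 0, ∀ t ∈ stdSimplex ℝ (Fin (n + 1)),
      dist t (dk : Fin (n + 1) → ℝ) < ε0 → Pt Γ u t ∈ κ '' Metric.ball 0 ρ := by
    intro u hu
    obtain ⟨ε0, h0, h1⟩ := Metric.isOpen_iff.1 (hW.preimage (pt_cont Γ u)) dk
      (by rw [Set.mem_preimage, hu]; exact hvW)
    refine ⟨ε0, h0, fun t ht hd => ?_⟩
    rw [Pt_eq Γ u t ht]
    exact h1 hd
  obtain ⟨ε1, hε1, hε1'⟩ := hnear x rfl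
  obtain ⟨ε2, hε2, hε2'⟩ := hnear y hvy
  set ε : ℝ := min (1 / 2) (min (ε1 / 2) (ε2 / 2)) with hεd
  have hε : 0 < ε := by positivity
  have hεh : ε ≤ 1 / 2 := min_le_left _ _
  have heps_a : ε < ε1 := by
    have : ε ≤ ε1 / 2 := (min_le_right _ _).trans (min_le_left _ _)
    linarith
  have heps_b : ε < ε2 := by
    have : ε ≤ ε2 / 2 := (min_le_right _ _).trans (min_le_right _ _)
    linarith
  let A := F → ℝ
  let τ : A → Fin (n + 1) → ℝ := fun u j =>
    if h : j ∈ F then ε * (u ⟨j, h⟩ / ∑ i, u i) else if j = k then 1 - ε else 0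
  have hkF : k ∉ F := by simp [hF]
  have hcF : c ∉ F := by simp [hF]
  have hτF : ∀ u j (h : j ∈ F), τ u j = ε * (u ⟨j, h⟩ / ∑ i, u i) := fun u j h => dif_pos h
  have hτk : ∀ u, τ u k = 1 - ε := fun u => by simp [τ, hkF]
  have hτc : ∀ u, τ u c = 0 := fun u => by simp [τ, hcF, hkc.symm]
  let D : Set A := {u | (∀ j, 0 ≤ u j) ∧ 1 ≤ ∑ j, u j ∧ ∑ j, u j ≤ 2}
  have huniv : (Finset.univ : Finset (Fin (n + 1))) = insert k (insert c F) := by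
    ext j; simp [hF]; tauto
  have hsumF : ∀ f : Fin (n + 1) → ℝ, ∑ j, f j = f k + (f c + ∑ j : F, f j) := by
    intro f
    rw [huniv, Finset.sum_insert (by simp [hkc, hkF]), Finset.sum_insert hcF,
      ← Finset.sum_coe_sort F f]
  have hτmem : ∀ u ∈ D, τ u ∈ stdSimplex ℝ (Fin (n + 1)) := by
    intro u hu
    have hpos : 0 < ∑ i, u i := lt_of_lt_of_le one_pos hu.2.1
    constructor
    · intro j
      by_cases h : j ∈ F
      · rw [hτF u j h]
        exact mul_nonneg hε.le (div_nonneg (hu.1 _) hpos.le)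
      · simp only [τ, h, dite_false]
        split_ifs
        · linarith
        · exact le_rfl
    · rw [hsumF, hτk, hτc]
      have : ∑ j : F, τ u j = ε := by
        rw [Finset.sum_congr rfl (fun (j : F) _ => hτF u j.1 j.2), ← Finset.mul_sum, ← Finset.sum_div,
          div_self hpos.ne', mul_one]
      rw [this]; ring
  have hτd : ∀ u ∈ D, dist (τ u) (dk : Fin (n + 1) → ℝ) ≤ ε := by
    intro u hu
    have hpos : 0 < ∑ i, u i := lt_of_lt_of_le one_pos hu.2.1
    rw [dist_pi_le_iff hε.le]
    intro j
    by_cases h : j ∈ F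
    · rw [hτF u j h, Real.dist_eq]
      have hjk : j ≠ k := ((hF j).1 h).1
      have hz : (dk : Fin (n + 1) → ℝ) j = 0 := Pi.single_eq_of_ne hjk _
      rw [hz, sub_zero]
      rw [abs_of_nonneg (mul_nonneg hε.le (div_nonneg (hu.1 _) hpos.le))]
      have : u ⟨j, h⟩ / ∑ i, u i ≤ 1 := by
        rw [div_le_one hpos]
        exact Finset.single_le_sum (fun i _ => hu.1 i) (Finset.mem_univ _)
      nlinarith
    · by_cases hjk : j = k
      · subst hjk
        rw [hτk, Real.dist_eq]
        simp [dk, abs_of_pos hε]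
      · have hjc : j = c := by
          by_contra hne
          exact h ((hF j).2 ⟨hjk, hne⟩)
        subst hjc
        rw [hτc]
        simp [dk, hjk, hε.le]
  have hτcont : ContinuousOn τ D := by
    rw [continuousOn_pi]
    intro j
    by_cases h : j ∈ F
    · simp only [hτF _ j h]
      refine continuousOn_const.mul (ContinuousOn.div (continuous_apply _).continuousOn
        (continuous_finsetSum _ fun i _ => continuous_apply i).continuousOn ?_)
      intro u hu
      exact (lt_of_lt_of_le one_pos hu.2.1).ne'
    · have : (fun u : A => τ u j) = fun _ => if j = k then 1 - ε else 0 := by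
        ext u; simp [τ, h]
      rw [this]
      exact continuousOn_const
  have hτdeg : ∀ u ∈ D, (∃ j, u j = 0) → Pt Γ x (τ u) = Pt Γ y (τ u) := by
    rintro u hu ⟨⟨j, hj⟩, huj⟩
    rw [Pt_eq Γ x _ (hτmem u hu), Pt_eq Γ y _ (hτmem u hu)]
    refine pt_reach Γ {c, j} x y _ (hR j ((hF j).1 hj).2) ?_
    rintro i (rfl | rfl)
    · exact hτc u
    · show τ u _ = 0
      rw [hτF u _ hj, huj]; simp
  let Se : Set A := D ∩ ({u | ∑ j, u j = 1} ∪ ⋃ j, {u | u j = 0})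
  let Sf : Set A := D ∩ ({u | ∑ j, u j = 2} ∪ ⋃ j, {u | u j = 0})
  have hsumc : Continuous fun u : A => ∑ j, u j :=
    continuous_finsetSum _ fun i _ => continuous_apply i
  have hDc : IsClosed D := by
    have : D = (⋂ j, {u : A | 0 ≤ u j}) ∩ ({u | 1 ≤ ∑ j, u j} ∩ {u | ∑ j, u j ≤ 2}) := by
      ext u; simp [D]
    rw [this]
    exact (isClosed_iInter fun j => isClosed_le continuous_const (continuous_apply j)).inter
      ((isClosed_le continuous_const hsumc).inter (isClosed_le hsumc continuous_const))
  have hzc : IsClosed (⋃ j, {u : A | u j = 0}) :=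
    isClosed_iUnion_of_finite fun j => isClosed_eq (continuous_apply j) continuous_const
  have hSec : IsClosed Se := hDc.inter ((isClosed_eq hsumc continuous_const).union hzc)
  have hSfc : IsClosed Sf := hDc.inter ((isClosed_eq hsumc continuous_const).union hzc)
  have hScomp : IsCompact (Se ∪ Sf) := by
    refine (isCompact_univ_pi (fun _ : F => isCompact_Icc (a := (0:ℝ)) (b := 2))).of_isClosed_subset
      (hSec.union hSfc) ?_
    intro u hu j _
    have huD : u ∈ D := by rcases hu with hu | hu <;> exact hu.1
    exact ⟨huD.1 j, (Finset.single_le_sum (fun i _ => huD.1 i) (Finset.mem_univ j)).trans huD.2.2⟩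
  let Eu : A → Γ.RealSp Set.univ := fun u => if u ∈ Se then Pt Γ x (τ u) else Pt Γ y (τ u)
  have hEe : ∀ u ∈ Se, Eu u = Pt Γ x (τ u) := fun u hu => if_pos hu
  have hEf : ∀ u ∈ Sf, Eu u = Pt Γ y (τ u) := by
    intro u hu
    by_cases hue : u ∈ Se
    · rw [hEe u hue]
      apply hτdeg u hu.1
      rcases hue.2 with h1 | h1
      · rcases hu.2 with h2 | h2
        · have h1' : ∑ j, u j = 1 := h1
          have h2' : ∑ j, u j = 2 := h2
          rw [h1'] at h2'; norm_num at h2'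
        · simpa using h2
      · simpa using h1
    · exact if_neg hue
  have hEc : ContinuousOn Eu (Se ∪ Sf) := by
    refine ContinuousOn.union_of_isClosed ?_ ?_ hSec hSfc
    · refine ContinuousOn.congr ?_ hEe
      exact (Pt_cont Γ x).comp (hτcont.mono inter_subset_left) (fun u hu => hτmem u hu.1)
    · refine ContinuousOn.congr ?_ hEf
      exact (Pt_cont Γ y).comp (hτcont.mono inter_subset_left) (fun u hu => hτmem u hu.1)
  have hEmem : ∀ u ∈ Se ∪ Sf, ∃ p ∈ Metric.ball (0 : EuclideanSpace ℝ (Fin n)) ρ, κ p = Eu u := by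
    rintro u (hu | hu)
    · rw [hEe u hu]
      exact hε1' _ (hτmem u hu.1) ((hτd u hu.1).trans_lt heps_a)
    · rw [hEf u hu]
      exact hε2' _ (hτmem u hu.1) ((hτd u hu.1).trans_lt heps_b)
  have hEk : ∀ u ∈ Se ∪ Sf, coT Γ (Eu u) k = 1 - ε := by
    rintro u (hu | hu)
    · rw [hEe u hu, Pt_eq Γ x _ (hτmem u hu.1), coT_pt]; exact hτk u
    · rw [hEf u hu, Pt_eq Γ y _ (hτmem u hu.1), coT_pt]; exact hτk u
  let h : A → EuclideanSpace ℝ (Fin n) := fun u =>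
    if hu : u ∈ Se ∪ Sf then (hEmem u hu).choose else 0
  have hκh : ∀ u ∈ Se ∪ Sf, h u ∈ Metric.ball (0 : EuclideanSpace ℝ (Fin n)) ρ ∧ κ (h u) = Eu u := by
    intro u hu
    simp only [h, hu, dite_true]
    exact (hEmem u hu).choose_spec
  obtain ⟨G, hGc, hGS, hG0, hGρ⟩ := extend_nonzero (A := A) (E := EuclideanSpace ℝ (Fin n))
    (by simp only [A, Module.finrank_fintype_fun_eq_card, Fintype.card_coe, finrank_euclideanSpace,
          Fintype.card_fin, hFcard]; omega)
    (Se ∪ Sf) hScomp h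
    (by
      rw [hκ.isInducing.continuousOn_iff]
      exact hEc.congr (fun u hu => (hκh u hu).2))
    (by
      intro u hu h0
      have h1 := (hκh u hu).2
      rw [h0, hκ0] at h1
      have h2 := hEk u hu
      rw [← h1] at h2
      simp [hv, coT_pt, dk] at h2
      linarith)
    ρ hρ (fun u hu => by simpa using (hκh u hu).1)
  have hκG : ∀ u ∈ Se ∪ Sf, κ (G u) = Eu u := fun u hu => by rw [hGS u hu, (hκh u hu).2]
  let res : (Fin (n + 1) → ℝ) → ℝ → A := fun s r j => (1 + r) * s j
  have hres_sum : ∀ s ∈ face F, ∀ r, ∑ j, res s r j = 1 + r := by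
    intro s hs r
    simp only [res]
    rw [← Finset.mul_sum]
    have := hsumF s
    rw [hs.2.1, hs.2.2 k hkF, hs.2.2 c hcF] at this
    rw [zero_add, zero_add] at this
    rw [← this, mul_one]
  have hresD : ∀ s ∈ face F, ∀ r ∈ Icc (0:ℝ) 1, res s r ∈ D := by
    intro s hs r hr
    refine ⟨fun j => mul_nonneg (by linarith [hr.1]) (hs.1 j), ?_, ?_⟩
    · rw [hres_sum s hs]; linarith [hr.1]
    · rw [hres_sum s hs]; linarith [hr.2]
  have hτres : ∀ s ∈ face F, ∀ r ∈ Icc (0:ℝ) 1, ∀ j, j ≠ k → τ (res s r) j = ε * s j := by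
    intro s hs r hr j hj
    by_cases h : j ∈ F
    · rw [hτF _ j h, hres_sum s hs]
      simp only [res]
      have : 1 + r ≠ 0 := by linarith [hr.1]
      field_simp
    · rw [hs.2.2 j h]; simp [τ, h, hj]
  have hτres' : ∀ s ∈ face F, ∀ r ∈ Icc (0:ℝ) 1, τ (res s r) = τ (res s 0) := by
    intro s hs r hr
    ext j
    by_cases hj : j = k
    · rw [hj, hτk, hτk]
    · rw [hτres s hs r hr j hj, hτres s hs 0 (by simp) j hj]
  let H : (Fin (n + 1) → ℝ) × ℝ → Γ.RealSp Set.univ := fun p => κ (G (res p.1 p.2))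
  have hHc : Continuous H := by
    refine hκ.continuous.comp (hGc.comp ?_)
    refine continuous_pi fun j => ?_
    exact (continuous_const.add continuous_snd).mul
      ((continuous_apply (j : Fin (n + 1))).comp continuous_fst)
  have hH0 : ∀ s ∈ face F, H (s, 0) = Pt Γ x (τ (res s 0)) := by
    intro s hs
    have hm : res s 0 ∈ Se := ⟨hresD s hs 0 (by simp), Or.inl (by
      show ∑ j, res s 0 j = 1
      rw [hres_sum s hs]; norm_num)⟩
    show κ (G (res s 0)) = _
    rw [hκG _ (Or.inl hm), hEe _ hm]
  have hH1 : ∀ s ∈ face F, H (s, 1) = Pt Γ y (τ (res s 0)) := by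
    intro s hs
    have hm : res s 1 ∈ Sf := ⟨hresD s hs 1 (by simp), Or.inl (by
      show ∑ j, res s 1 j = 2
      rw [hres_sum s hs]; norm_num)⟩
    show κ (G (res s 1)) = _
    rw [hκG _ (Or.inr hm), hEf _ hm, hτres' s hs 1 (by simp)]
  have hmem0 : ∀ s ∈ face F, τ (res s 0) ∈ stdSimplex ℝ (Fin (n + 1)) :=
    fun s hs => hτmem _ (hresD s hs 0 (by simp))
  have hpos0 : ∀ s ∈ face F, (∀ a ∈ F, 0 < s a) → ∀ j, j ≠ c → 0 < τ (res s 0) j := by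
    intro s hs ha j hj
    by_cases hjk : j = k
    · rw [hjk, hτk]; linarith
    · rw [hτres s hs 0 (by simp) j hjk]
      exact mul_pos hε (ha j ((hF j).2 ⟨hjk, hj⟩))
  refine no_homotopy k c hkc F hF ⟨i0, hi0⟩ (coT Γ) (coT_cont Γ) (gf Γ γ hγ) (gf_open Γ γ hγ)
    ?_ H hHc ?_ ?_ ε hε ?_ ?_ ?_ ?_
  · intro q hq
    obtain ⟨u, t, rfl⟩ := pt_surj Γ q
    rw [← hsum u]
    exact Finset.sum_congr rfl fun i _ => gf_pt Γ γ hγ i u t (fun j _ => hq j)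
  · intro s hs r hr
    have hb : H (s, r) ∈ O := hρO (by simpa using hGρ (res s r))
    refine ⟨hb.1, ?_⟩
    by_contra! hcon
    have hne : H (s, r) ≠ v := by
      intro he
      rw [← hκ0] at he
      exact hG0 _ (hκ.injective he)
    obtain ⟨u, t, hq⟩ := pt_surj Γ (H (s, r))
    rw [hq] at hcon hne hb
    have ht : t = dk := by
      have h0 : ∀ j, j ≠ k → (t : Fin (n + 1) → ℝ) j = 0 := fun j hj =>
        le_antisymm (hcon j hj) (t.2.1 j)
      ext j
      by_cases hj : j = k
      · subst hj
        have : ∑ i, t i = 1 := t.2.2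
        rw [Finset.sum_eq_single j (fun b _ hb => h0 b hb) (by simp)] at this
        simpa [dk] using this
      · rw [h0 j hj]; simp [dk, hj]
    rw [ht] at hne hb
    exact hb.2 ⟨⟨u, rfl⟩, hne⟩
  · rintro s hs r hr ⟨a, ha, hsa⟩
    have hm : res s r ∈ Se := ⟨hresD s hs r hr, Or.inr (mem_iUnion.2 ⟨⟨a, ha⟩, by
      show (1 + r) * s a = 0
      rw [hsa, mul_zero]⟩)⟩
    rw [hH0 s hs, ← hτres' s hs r hr]
    show κ (G (res s r)) = _
    rw [hκG _ (Or.inl hm), hEe _ hm]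
  · intro s hs j hj
    rw [hH0 s hs, Pt_eq Γ x _ (hmem0 s hs), coT_pt]
    exact hτres s hs 0 (by simp) j hj
  · intro s hs j hj
    rw [hH1 s hs, Pt_eq Γ y _ (hmem0 s hs), coT_pt]
    exact hτres s hs 0 (by simp) j hj
  · intro s hs ha
    rw [hH0 s hs, Pt_eq Γ x _ (hmem0 s hs), gf_pt, hx]
    exact hpos0 s hs ha
  · intro s hs ha
    rw [hH1 s hs, Pt_eq Γ y _ (hmem0 s hs), gf_pt, hy]
    exact hpos0 s hs ha

end Stmt8

namespace Stmt8

open PCG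

lemma two_colouring {V : Type} [Fintype V] (σ τ : V → V) (hσ : Function.Involutive σ)
    (hτ : Function.Involutive τ) (fσ : ∀ v, σ v ≠ v) (fτ : ∀ v, τ v ≠ v) :
    ∃ b : V → Bool, (∀ v, b (σ v) ≠ b v) ∧ ∀ v, b (τ v) ≠ b v := by
  classical
  let s : Equiv.Perm V := hσ.toPerm
  let t : Equiv.Perm V := hτ.toPerm
  let π : Equiv.Perm V := t * s
  have hss : s * s = 1 := by ext v; exact hσ v
  have htt : t * t = 1 := by ext v; exact hτ v
  have hs1 : s⁻¹ = s := inv_eq_of_mul_eq_one_left hss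
  have ht1 : t⁻¹ = t := inv_eq_of_mul_eq_one_left htt
  have hconj : s * π * s⁻¹ = π⁻¹ := by
    simp only [π, mul_inv_rev, hs1, ht1]
    rw [mul_assoc, mul_assoc, hss, mul_one]
  have hcz : ∀ m : ℤ, s * π ^ m = π ^ (-m) * s := by
    intro m
    have h := conj_zpow (i := m) (a := s) (b := π)
    rw [hconj] at h
    rw [zpow_neg, ← inv_zpow, h, inv_mul_cancel_right]
  have hnot : ∀ v, ¬ π.SameCycle v (σ v) := by
    rintro v ⟨m, hm⟩
    have hm' : (π ^ m) v = s v := hm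
    rcases Int.even_or_odd' m with ⟨l, rfl | rfl⟩
    · apply fσ ((π ^ l) v)
      show s ((π ^ l) v) = (π ^ l) v
      rw [← Equiv.Perm.mul_apply, hcz, Equiv.Perm.mul_apply, ← hm', ← Equiv.Perm.mul_apply,
        ← zpow_add]
      congr 2
      ring
    · apply fτ (s ((π ^ l) v))
      show t (s ((π ^ l) v)) = s ((π ^ l) v)
      have h1 : t (s ((π ^ l) v)) = (π ^ (l + 1)) v := by
        rw [add_comm, zpow_add, zpow_one]; rfl
      rw [h1, ← Equiv.Perm.mul_apply, hcz, Equiv.Perm.mul_apply, ← hm', ← Equiv.Perm.mul_apply,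
        ← zpow_add]
      congr 2
      ring
  let S := Equiv.Perm.SameCycle.setoid π
  let N : V → ℕ := fun v => (Fintype.equivFin (Quotient S) (Quotient.mk S v) : ℕ)
  have hN : ∀ v w, N v = N w ↔ π.SameCycle v w := by
    intro v w
    simp only [N, Fin.val_inj, EmbeddingLike.apply_eq_iff_eq]
    exact Quotient.eq
  have hτσ : ∀ v, N (τ v) = N (σ v) := by
    intro v
    rw [hN, Equiv.Perm.sameCycle_comm]
    refine ⟨1, ?_⟩
    show τ (σ (σ v)) = τ v
    rw [hσ]
  have hστ : ∀ v, N (σ (τ v)) = N v := by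
    intro v
    rw [hN]
    refine ⟨1, ?_⟩
    show τ (σ (σ (τ v))) = v
    rw [hσ, hτ]
  have hne : ∀ v, N v ≠ N (σ v) := fun v h => hnot v ((hN _ _).1 h)
  refine ⟨fun v => decide (N v < N (σ v)), fun v => ?_, fun v => ?_⟩
  · have := hne v
    simp only [ne_eq, decide_eq_decide, hσ v]
    omega
  · have := hne v
    simp only [ne_eq, decide_eq_decide, hτσ, hστ]
    omega

lemma add_edge {n : ℕ} {V : Type} [DecidableEq V] (Γ : PCG n V) (k j : Fin (n + 1)) (hjk : j ≠ k)
    (a : V) (γ : V → Fin (n + 1) → ZMod 2) (hγ : ∀ i u, γ (Γ.inv i u) i = γ u i) :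
    ∃ γ' : V → Fin (n + 1) → ZMod 2, (∀ i u, γ' (Γ.inv i u) i = γ' u i) ∧
      (∀ v, ∑ i ∈ Finset.univ.erase k, γ' v i = ∑ i ∈ Finset.univ.erase k, γ v i +
        ((if v = a then 1 else 0) + (if v = Γ.inv j a then 1 else 0))) ∧
      (∀ v i, γ' v i = γ v i + if i = j ∧ (v = a ∨ v = Γ.inv j a) then 1 else 0) := by
  refine ⟨fun v i => γ v i + if i = j ∧ (v = a ∨ v = Γ.inv j a) then 1 else 0, ?_, ?_,
    fun v i => rfl⟩
  · intro i u
    simp only [hγ]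
    congr 1
    refine if_congr ?_ rfl rfl
    constructor
    · rintro ⟨rfl, h | h⟩
      · exact ⟨rfl, Or.inr (by rw [← h, Γ.involutive])⟩
      · exact ⟨rfl, Or.inl ((Γ.involutive i).injective h)⟩
    · rintro ⟨rfl, h | h⟩
      · exact ⟨rfl, Or.inr (by rw [h])⟩
      · exact ⟨rfl, Or.inl (by rw [h, Γ.involutive])⟩
  · intro v
    rw [Finset.sum_add_distrib]
    congr 1
    rw [Finset.sum_eq_single j]
    · have := Γ.fixedfree j a
      by_cases h1 : v = a
      · subst h1; simp [this.symm]
      · simp [h1]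
    · intro i _ hi; simp [hi]
    · intro h; simp [hjk] at h

/-- reachability avoiding the colour `k` and the `c`-edges at the bad vertices -/
def Avoid {n : ℕ} {V : Type} (Γ : PCG n V) (k c : Fin (n + 1)) (bad : Set V) (a b : V) : Prop :=
  ∃ j, j ≠ k ∧ (j ≠ c ∨ a ∉ bad) ∧ Γ.inv j a = b

lemma path_gamma {n : ℕ} {V : Type} [DecidableEq V] (Γ : PCG n V) (k c : Fin (n + 1))
    (bad : Set V) (hbad : ∀ v ∈ bad, Γ.inv c v ∈ bad) (x u : V)
    (h : Relation.ReflTransGen (Avoid Γ k c bad) x u) :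
    ∃ γ : V → Fin (n + 1) → ZMod 2, (∀ i u, γ (Γ.inv i u) i = γ u i) ∧
      (∀ v, ∑ i ∈ Finset.univ.erase k, γ v i =
        (if v = x then 1 else 0) + (if v = u then 1 else 0)) ∧ ∀ v ∈ bad, γ v c = 0 := by
  induction h with
  | refl =>
    refine ⟨fun _ _ => 0, by simp, fun v => ?_, by simp⟩
    rw [CharTwo.add_self_eq_zero]; simp
  | @tail a b _ hs ih =>
    obtain ⟨γ, h1, h2, h3⟩ := ih
    obtain ⟨j, hjk, hj, rfl⟩ := hs
    obtain ⟨γ', h1', h2', h3'⟩ := add_edge Γ k j hjk a γ h1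
    refine ⟨γ', h1', fun v => ?_, fun v hv => ?_⟩
    · rw [h2', h2, add_assoc, ← add_assoc (if v = a then (1 : ZMod 2) else 0),
        CharTwo.add_self_eq_zero, zero_add]
    · rw [h3', h3 v hv, zero_add, if_neg]
      rintro ⟨rfl, hva⟩
      have hab : a ∉ bad := by simpa using hj
      rcases hva with rfl | rfl
      · exact hab hv
      · have := hbad _ hv
        rw [Γ.involutive] at this
        exact hab this

theorem sep_core {n : ℕ} {V : Type} [Fintype V] [DecidableEq V] (hn : 3 ≤ n)
    (X : Type) [TopologicalSpace X] (hX : IsClosedManifoldN n X)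
    (Γ : PCG n V) (hgem : Γ.IsGemOf X) (c k : Fin (n + 1)) (hkc : k ≠ c) (x y : V)
    (hR : ∀ i, i ≠ c → Γ.sameCycle c i x y)
    (y1 y0 : V) (hy0 : Γ.inv c y1 = y0) (hyy : y = y1 ∨ y = y0)
    (hyx : y ≠ x) (hyxc : y ≠ Γ.inv c x)
    (hb : ∀ i, i ≠ c → ∀ b : V → Bool, (∀ w, b (Γ.inv c w) ≠ b w) →
      (∀ w, b (Γ.inv i w) ≠ b w) → b y1 ≠ b x) :
    ∃ C : Set V, x ∈ C ∧ y1 ∈ C ∧ Γ.inv c x ∉ C ∧ y0 ∉ C ∧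
      (∀ u ∈ C, ∀ j, j ≠ k → j ≠ c → Γ.inv j u ∈ C) ∧
      (∀ u ∈ C, u ≠ x → u ≠ y1 → Γ.inv c u ∈ C) := by
  classical
  set xc := Γ.inv c x with hxc
  have hxcx : Γ.inv c xc = x := Γ.involutive c x
  have hy01 : Γ.inv c y0 = y1 := by rw [← hy0]; exact Γ.involutive c y1
  have hbadc : ∀ v ∈ ({x, xc, y1, y0} : Set V), Γ.inv c v ∈ ({x, xc, y1, y0} : Set V) := by
    rintro v (rfl | rfl | rfl | rfl)
    · simp [hxc]
    · simp [hxcx]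
    · simp [hy0]
    · simp [hy01]
  have d1 : x ≠ xc := (Γ.fixedfree c x).symm
  have d2 : y1 ≠ y0 := by rw [← hy0]; exact (Γ.fixedfree c y1).symm
  have d3 : y1 ≠ x := by
    rcases hyy with rfl | rfl
    · exact hyx
    · rintro rfl; exact hyxc (hy0.symm.trans hxc.symm)
  have d4 : y1 ≠ xc := by
    rcases hyy with rfl | rfl
    · exact hyxc
    · intro h; apply hyx; rw [← hy0, h, hxcx]
  have d5 : y0 ≠ x := by
    intro h; apply d4; rw [← hy01, h]
  have d6 : y0 ≠ xc := by
    intro h; apply d3; rw [← hy01, h, hxcx]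
  let C : Set V := {u | Relation.ReflTransGen (Avoid Γ k c {x, xc, y1, y0}) x u}
  have hxC : x ∈ C := Relation.ReflTransGen.refl
  have hCj : ∀ u ∈ C, ∀ j, j ≠ k → j ≠ c → Γ.inv j u ∈ C := fun u hu j hk hc =>
    Relation.ReflTransGen.tail hu ⟨j, hk, Or.inl hc, rfl⟩
  have hCc : ∀ u ∈ C, u ∉ ({x, xc, y1, y0} : Set V) → Γ.inv c u ∈ C := fun u hu hn =>
    Relation.ReflTransGen.tail hu ⟨c, hkc.symm, Or.inr hn, rfl⟩
  have hxcC : xc ∉ C := by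
    intro h
    obtain ⟨γ, h1, h2, h3⟩ := path_gamma Γ k c _ hbadc x xc h
    obtain ⟨γ', h1', h2', h3'⟩ := add_edge Γ k c hkc.symm x γ h1
    refine no_gamma hn X hX Γ hgem c k hkc x y hR γ' h1' ?_ ?_ ?_
    · intro v
      rw [h2', h2, ← hxc, CharTwo.add_self_eq_zero]
    · rw [h3', h3 x (by simp)]; simp
    · rw [h3', h3 y (by rcases hyy with rfl | rfl <;> simp), if_neg, add_zero]
      rintro ⟨-, h | h⟩
      · exact hyx h
      · exact hyxc h
  obtain ⟨i, hi⟩ : ((Finset.univ.erase k).erase c : Finset (Fin (n + 1))).Nonempty := by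
    rw [← Finset.card_pos, Finset.card_erase_of_mem (by simp [hkc.symm]),
      Finset.card_erase_of_mem (by simp)]
    simp; omega
  simp only [Finset.mem_erase, Finset.mem_univ, and_true] at hi
  obtain ⟨b, hb1, hb2⟩ := two_colouring (Γ.inv c) (Γ.inv i) (Γ.involutive c) (Γ.involutive i)
    (Γ.fixedfree c) (Γ.fixedfree i)
  have hby := hb i hi.1 b hb1 hb2
  let s : V → ℤ := fun v => if b v then 1 else -1
  have hs : ∀ v w, b v ≠ b w → s v + s w = 0 := by
    intro v w h
    simp only [s]
    cases hv : b v <;> cases hw : b w <;> simp_all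
  have sum1 : ∑ v ∈ Finset.univ.filter (· ∈ C), s v = 0 := by
    refine Finset.sum_involution (fun v _ => Γ.inv i v) ?_ ?_ ?_ ?_
    · intro v _; exact hs _ _ (hb2 v).symm
    · intro v _ _; exact Γ.fixedfree i v
    · intro v hv
      simp only [Finset.mem_filter, Finset.mem_univ, true_and] at hv ⊢
      exact hCj v hv i hi.2 hi.1
    · intro v _; exact Γ.involutive i v
  have sum2 : ∑ v ∈ (Finset.univ.filter (· ∈ C)).filter
      (fun v => v ∉ ({x, xc, y1, y0} : Set V)), s v = 0 := by
    refine Finset.sum_involution (fun v _ => Γ.inv c v) ?_ ?_ ?_ ?_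
    · intro v _; exact hs _ _ (hb1 v).symm
    · intro v _ _; exact Γ.fixedfree c v
    · intro v hv
      rw [Finset.mem_filter, Finset.mem_filter] at hv ⊢
      refine ⟨⟨Finset.mem_univ _, hCc v hv.1.2 hv.2⟩, fun h => hv.2 ?_⟩
      have := hbadc _ h
      rwa [Γ.involutive] at this
    · intro v _; exact Γ.involutive c v
  have sum3 : ∑ v ∈ (Finset.univ.filter (· ∈ C)).filter
      (fun v => v ∈ ({x, xc, y1, y0} : Set V)), s v = 0 := by
    have := Finset.sum_filter_add_sum_filter_not (Finset.univ.filter (· ∈ C))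
      (fun v => v ∈ ({x, xc, y1, y0} : Set V)) s
    rw [sum1, sum2, add_zero] at this
    exact this
  have hset : (Finset.univ.filter (· ∈ C)).filter
      (fun v => v ∈ ({x, xc, y1, y0} : Set V)) = ({x, y1, y0} : Finset V).filter (· ∈ C) := by
    ext v
    simp only [Finset.mem_filter, Finset.mem_univ, true_and, Set.mem_insert_iff,
      Set.mem_singleton_iff, Finset.mem_insert, Finset.mem_singleton]
    constructor
    · rintro ⟨h, rfl | rfl | h'⟩
      · exact ⟨Or.inl rfl, h⟩
      · exact absurd h hxcC
      · exact ⟨Or.inr h', h⟩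
    · rintro ⟨h | h, h'⟩
      · exact ⟨h', Or.inl h⟩
      · exact ⟨h', Or.inr (Or.inr h)⟩
  rw [hset, Finset.sum_filter, Finset.sum_insert (by simp [d3.symm, d5.symm]),
    Finset.sum_insert (by simp [d2]), Finset.sum_singleton, if_pos hxC] at sum3
  have e1 := hs y1 x hby
  have e2 : s y1 + s y0 = 0 := hs _ _ (by rw [← hy0]; exact (hb1 y1).symm)
  have e3 : s x = 1 ∨ s x = -1 := by
    simp only [s]; split_ifs <;> simp
  have hfin : y1 ∈ C ∧ y0 ∉ C := by
    by_cases h1 : y1 ∈ C <;> by_cases h0 : y0 ∈ C <;> simp only [h1, h0, if_true, if_false] at sum3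
    · omega
    · exact ⟨h1, h0⟩
    · omega
    · omega
  refine ⟨C, hxC, hfin.1, hxcC, hfin.2, hCj, fun u hu h1 h2 => hCc u hu ?_⟩
  rintro (h | rfl | h | rfl)
  · exact h1 h
  · exact hxcC hu
  · exact h2 h
  · exact hfin.2 hu

end Stmt8

/-- Let `Γ` be a gem of a connected closed `n`-manifold, `n ≥ 3`, `R` a
`ρₙ`-pair involving colour `c` with `e = {x, Γ.inv c x}` (oriented with tail
`e(0) = x`), `Γ'` the standard switching of `R`, and let `Γ̃` (on vertex set
`V ⊕ Fin 2`, the two new vertices being `A = inr 0` and `B = inr 1`) be obtained from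
`Γ'` by adding a blob on the new edge `f'` joining `e(1) = Γ.inv c x` to
`f(0) = Γ'.inv c (Γ.inv c x)`.  Then `e(0)` and `B` are completely separated in `Γ̃`,
and `Γ` is colour-isomorphic to the fusion graph `Γ̃ fus(e(0), B)`. -/
theorem stmt8 {n : ℕ} {V : Type} [Fintype V] [DecidableEq V] (hn : 3 ≤ n)
    (X : Type) [TopologicalSpace X] [ConnectedSpace X]
    (hX : IsClosedManifoldN n X)
    (Γ Γ' : PCG n V) (hgem : Γ.IsGemOf X)
    (c : Fin (n + 1)) (x y : V) (hR : Γ.IsRhoN c x y)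
    (hS : Γ.IsStdSwitch Γ' c x y)
    (Γt : PCG n (V ⊕ Fin 2))
    (hkeep : ∀ j : Fin (n + 1), ∀ v : V,
      (j ≠ c ∨ (v ≠ Γ.inv c x ∧ v ≠ Γ'.inv c (Γ.inv c x))) →
      Γt.inv j (Sum.inl v) = Sum.inl (Γ'.inv j v))
    (hA : Γt.inv c (Sum.inl (Γ.inv c x)) = Sum.inr 0)
    (hB : Γt.inv c (Sum.inl (Γ'.inv c (Γ.inv c x))) = Sum.inr 1)
    (hblob : ∀ j, j ≠ c → Γt.inv j (Sum.inr 0) = Sum.inr 1) :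
    (∀ k : Fin (n + 1), ¬Γt.reach {k}ᶜ (Sum.inl x) (Sum.inr 1)) ∧
    ∃ θ : V ≃ {w : V ⊕ Fin 2 // w ≠ Sum.inl x ∧ w ≠ Sum.inr 1},
      ∀ j v, ((θ (Γ.inv j v) : V ⊕ Fin 2)) =
        (if Γt.inv j (θ v) = Sum.inl x then Γt.inv j (Sum.inr 1)
         else if Γt.inv j (θ v) = Sum.inr 1 then Γt.inv j (Sum.inl x)
         else Γt.inv j (θ v)) := by
  classical
  obtain ⟨⟨hyx, hyxc⟩, hcyc⟩ := hR
  obtain ⟨⟨hS1, hS2, hS3⟩, hS4⟩ := hS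
  obtain ⟨y1, hy1⟩ : ∃ y1, y1 = Γ'.inv c x := ⟨_, rfl⟩
  obtain ⟨y0, hy0⟩ : ∃ y0, y0 = Γ'.inv c (Γ.inv c x) := ⟨_, rfl⟩
  obtain ⟨xc, hxc⟩ : ∃ xc, xc = Γ.inv c x := ⟨_, rfl⟩
  rw [← hy0] at hB
  rw [← hxc] at hA
  simp only [← hxc] at hkeep
  have hy0x : Γ'.inv c xc = y0 := by rw [hy0, hxc]
  simp only [hy0x] at hkeep
  have hy10 : Γ.inv c y1 = y0 := by
    rcases hS3 with ⟨h1, h2⟩ | ⟨h1, h2⟩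
    · rw [hy1, hy0, h1, h2]
    · rw [hy1, hy0, h1, h2]; exact Γ.involutive c y
  have hyy : y = y1 ∨ y = y0 := by
    rcases hS3 with ⟨h1, h2⟩ | ⟨h1, h2⟩
    · left; rw [hy1, h1]
    · right; rw [hy0, h2]
  have hy01 : Γ.inv c y0 = y1 := by rw [← hy10]; exact Γ.involutive c y1
  have hxcx : Γ.inv c xc = x := by rw [hxc]; exact Γ.involutive c x
  have hpx : Γ'.inv c y1 = x := by rw [hy1]; exact Γ'.involutive c x
  have d1 : x ≠ xc := by rw [hxc]; exact (Γ.fixedfree c x).symm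
  have d2 : y1 ≠ y0 := by rw [← hy10]; exact (Γ.fixedfree c y1).symm
  have d3 : y1 ≠ x := by rw [hy1]; exact Γ'.fixedfree c x
  have d4 : y0 ≠ xc := by rw [hy0, ← hxc]; exact Γ'.fixedfree c xc
  have d5 : y0 ≠ x := by
    intro h
    rcases hyy with e | e
    · apply hyxc; rw [e, ← hy01, h]
    · exact hyx (e.trans h)
  have d6 : y1 ≠ xc := by
    intro h; apply d5; rw [← hy10, h, hxcx]
  have hrest : ∀ v, v ≠ x → v ≠ xc → v ≠ y1 → v ≠ y0 → Γ'.inv c v = Γ.inv c v := by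
    intro v h1 h2 h3 h4
    refine hS2 v h1 ?_ (by rw [← hxc]; exact h2) ?_
    · rcases hyy with e | e
      · rw [e]; exact h3
      · rw [e]; exact h4
    · rcases hyy with e | e
      · rw [e, hy10]; exact h4
      · rw [e, hy01]; exact h3
  have hAi : Γt.inv c (Sum.inr 0) = Sum.inl xc := by rw [← hA]; exact Γt.involutive c _
  have hBi : Γt.inv c (Sum.inr 1) = Sum.inl y0 := by rw [← hB]; exact Γt.involutive c _
  have hblob' : ∀ j, j ≠ c → Γt.inv j (Sum.inr 1) = Sum.inr 0 := by
    intro j hj; rw [← hblob j hj]; exact Γt.involutive j _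
  have hkj : ∀ j, j ≠ c → ∀ v, Γt.inv j (Sum.inl v) = Sum.inl (Γ.inv j v) := by
    intro j hj v; rw [hkeep j v (Or.inl hj), hS1 j hj]
  have hkx : Γt.inv c (Sum.inl x) = Sum.inl y1 := by
    rw [hkeep c x (Or.inr ⟨d1, d5.symm⟩), hy1]
  have hky : Γt.inv c (Sum.inl y1) = Sum.inl x := by
    rw [hkeep c y1 (Or.inr ⟨d6, d2⟩), hpx]
  have hkr : ∀ v, v ≠ x → v ≠ xc → v ≠ y1 → v ≠ y0 →
      Γt.inv c (Sum.inl v) = Sum.inl (Γ.inv c v) := by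
    intro v h1 h2 h3 h4
    rw [hkeep c v (Or.inr ⟨h2, h4⟩), hrest v h1 h2 h3 h4]
  constructor
  · intro k hreach
    by_cases hkc : k = c
    · subst hkc
      have : ∀ w, Γt.reach {k}ᶜ (Sum.inl x) w → ∃ u, w = Sum.inl u := by
        intro w hw
        induction hw with
        | refl => exact ⟨x, rfl⟩
        | tail _ hs ih =>
          obtain ⟨u, rfl⟩ := ih
          obtain ⟨j, hj, rfl⟩ := hs
          exact ⟨_, hkj j hj u⟩
      obtain ⟨u, hu⟩ := this _ hreach
      simp at hu
    · obtain ⟨C, hC1, hC2, hC3, hC4, hC5, hC6⟩ := Stmt8.sep_core hn X hX Γ hgem c k hkc x y hcyc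
        y1 y0 hy10 hyy hyx hyxc (by rw [hy1]; exact hS4)
      rw [← hxc] at hC3
      have : ∀ w, Γt.reach {k}ᶜ (Sum.inl x) w → ∃ u ∈ C, w = Sum.inl u := by
        intro w hw
        induction hw with
        | refl => exact ⟨x, hC1, rfl⟩
        | tail _ hs ih =>
          obtain ⟨u, huC, rfl⟩ := ih
          obtain ⟨j, hj, rfl⟩ := hs
          by_cases hjc : j = c
          · subst hjc
            by_cases h1 : u = x
            · rw [h1, hkx]; exact ⟨y1, hC2, rfl⟩
            by_cases h2 : u = y1
            · rw [h2, hky]; exact ⟨x, hC1, rfl⟩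
            refine ⟨_, hC6 u huC h1 h2, hkr u h1 ?_ h2 ?_⟩
            · rintro rfl; exact hC3 huC
            · rintro rfl; exact hC4 huC
          · exact ⟨_, hC5 u huC j hj hjc, hkj j hjc u⟩
      obtain ⟨u, -, hu⟩ := this _ hreach
      simp at hu
  · let θ : V ≃ {w : V ⊕ Fin 2 // w ≠ Sum.inl x ∧ w ≠ Sum.inr 1} :=
      { toFun := fun v => if h : v = x then ⟨Sum.inr 0, by simp⟩ else ⟨Sum.inl v, by simp [h]⟩
        invFun := fun w => Sum.elim id (fun _ => x) w.1
        left_inv := by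
          intro v
          by_cases h : v = x <;> simp [h]
        right_inv := by
          rintro ⟨w | w, h1, h2⟩
          · have : w ≠ x := fun h => h1 (by rw [h])
            simp [this]
          · have : w = 0 := by
              have : w ≠ 1 := fun h => h2 (by rw [h])
              omega
            subst this
            simp }
    have hθx : ((θ x : V ⊕ Fin 2)) = Sum.inr 0 := by simp [θ]
    have hθ : ∀ v, v ≠ x → ((θ v : V ⊕ Fin 2)) = Sum.inl v := by
      intro v hv; simp [θ, hv]
    refine ⟨θ, fun j v => ?_⟩
    by_cases hv : v = x
    · subst hv
      rw [hθx, hθ _ (Γ.fixedfree j v)]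
      by_cases hj : j = c
      · subst hj
        rw [hAi, if_neg (by simpa using d1.symm), if_neg (by simp), hxc]
      · rw [hblob j hj, if_neg (by simp), if_pos rfl, hkj j hj]
    · rw [hθ v hv]
      by_cases hj : j = c
      · subst hj
        by_cases h1 : v = xc
        · rw [h1, hA, hxcx, hθx, if_neg (by simp), if_neg (by simp)]
        by_cases h2 : v = y0
        · rw [h2, hB, hy01, hθ _ d3, if_neg (by simp), if_pos rfl, hkx]
        by_cases h3 : v = y1
        · rw [h3, hky, hy10, hθ _ d5, if_pos rfl, hBi]
        have h4 : Γ.inv j v ≠ x := by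
          intro h; apply h1; rw [hxc, ← h]; exact (Γ.involutive j v).symm
        rw [hkr v hv h1 h3 h2, hθ _ h4, if_neg (by simpa using h4), if_neg (by simp)]
      · rw [hkj j hj]
        by_cases h4 : Γ.inv j v = x
        · rw [h4, hθx, if_pos rfl, hblob' j hj]
        · rw [hθ _ h4, if_neg (by simpa using h4), if_neg (by simp)]
end

section
/- A crystallization of the n-sphere Sⁿ, n ≥ 2, contains no ρ_n-pair. -/
open Set

namespace SpChain

/-- mod-2 chains of lists of points -/
abbrev Ch (E : Type) := List E →₀ ZMod 2

noncomputable def cone {E : Type} (b : E) : Ch E →ₗ[ZMod 2] Ch E :=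
  Finsupp.linearCombination (ZMod 2) (fun τ => Finsupp.single (b :: τ) 1)

noncomputable def bdL {E : Type} : List E → Ch E
  | [] => 0
  | b :: τ => Finsupp.single τ 1 + cone b (bdL τ)

noncomputable def bd {E : Type} : Ch E →ₗ[ZMod 2] Ch E :=
  Finsupp.linearCombination (ZMod 2) bdL

@[simp] lemma cone_single {E : Type} (b : E) (τ : List E) :
    cone b (Finsupp.single τ 1) = Finsupp.single (b :: τ) 1 := by
  simp [cone]

@[simp] lemma bd_single {E : Type} (τ : List E) : bd (Finsupp.single τ 1) = bdL τ := by
  simp [bd]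

lemma lin_ext {E : Type} {M : Type*} [AddCommMonoid M] [Module (ZMod 2) M]
    (f g : Ch E →ₗ[ZMod 2] M) (h : ∀ τ, f (Finsupp.single τ 1) = g (Finsupp.single τ 1))
    (z : Ch E) : f z = g z := by
  have : f = g := by
    apply Finsupp.lhom_ext'
    intro τ
    apply LinearMap.ext_ring
    simpa using h τ
  rw [this]

lemma bd_cone {E : Type} (b : E) (z : Ch E) : bd (cone b z) = z + cone b (bd z) := by
  refine lin_ext (bd ∘ₗ cone b) (LinearMap.id + cone b ∘ₗ bd) ?_ z
  intro τ
  simp [bdL]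

lemma bd_bdL {E : Type} (τ : List E) : bd (bdL τ) = 0 := by
  induction τ with
  | nil => simp [bdL]
  | cons b τ ih =>
    simp only [bdL, map_add, bd_single, bd_cone, ih, map_zero, add_zero]
    exact ZModModule.add_self _

lemma bd_bd {E : Type} (z : Ch E) : bd (bd z) = 0 := by
  apply lin_ext (bd ∘ₗ bd) 0
  intro τ
  simp [bd_bdL]

/-! supported chains -/

abbrev supp {E : Type} (p : List E → Prop) : Submodule (ZMod 2) (Ch E) :=
  Finsupp.supported (ZMod 2) (ZMod 2) {τ | p τ}

lemma single_supp {E : Type} {p : List E → Prop} {τ : List E} (h : p τ) :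
    Finsupp.single τ 1 ∈ supp p := Finsupp.single_mem_supported _ _ h

lemma supp_mono {E : Type} {p q : List E → Prop} (h : ∀ τ, p τ → q τ) {z : Ch E}
    (hz : z ∈ supp p) : z ∈ supp q := Finsupp.supported_mono (fun τ ht => h τ ht) hz

lemma map_supp {M : Type*} {E : Type} [AddCommMonoid M] [Module (ZMod 2) M]
    {p : List E → Prop} (W : Submodule (ZMod 2) M) (f : Ch E →ₗ[ZMod 2] M)
    (h : ∀ τ, p τ → f (Finsupp.single τ 1) ∈ W) {z : Ch E} (hz : z ∈ supp p) : f z ∈ W := by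
  rw [supp, Finsupp.supported_eq_span_single] at hz
  have : Submodule.span (ZMod 2) ((fun i => Finsupp.single i (1 : ZMod 2)) '' {τ | p τ})
      ≤ W.comap f := by
    rw [Submodule.span_le]
    rintro _ ⟨τ, ht, rfl⟩
    exact h τ ht
  exact this hz

lemma eq_on_supp {E : Type} {M : Type*} [AddCommGroup M] [Module (ZMod 2) M]
    {p : List E → Prop} (f g : Ch E →ₗ[ZMod 2] M)
    (h : ∀ τ, p τ → f (Finsupp.single τ 1) = g (Finsupp.single τ 1)) {z : Ch E}
    (hz : z ∈ supp p) : f z = g z := by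
  have : (f - g) z ∈ (⊥ : Submodule (ZMod 2) M) := map_supp ⊥ (f - g) (by
    intro τ ht
    simp [h τ ht]) hz
  simpa [sub_eq_zero] using this

lemma cone_supp {E : Type} {p q : List E → Prop} (b : E) (h : ∀ τ, p τ → q (b :: τ)) {z : Ch E}
    (hz : z ∈ supp p) : cone b z ∈ supp q :=
  map_supp _ (cone b) (fun τ ht => by rw [cone_single]; exact single_supp (h τ ht)) hz

/-- the boundary of a list consists of sublists of length one less -/
lemma bdL_supp {E : Type} (τ : List E) :
    bdL τ ∈ supp (fun ρ => ρ.length + 1 = τ.length ∧ ρ.Sublist τ) := by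
  induction τ with
  | nil => simp [bdL]
  | cons b τ ih =>
    rw [bdL]
    refine add_mem (single_supp (by simp)) (cone_supp b ?_ ih)
    rintro ρ ⟨h1, h2⟩
    exact ⟨by simp [h1], h2.cons_cons b⟩

/-! labels -/

noncomputable def full {E ι : Type} [DecidableEq ι] (l : E → ι) (S : Finset ι) (τ : List E) :
    ZMod 2 :=
  if τ.length = S.card ∧ (τ.map l).toFinset = S then 1 else 0

noncomputable def fullL {E ι : Type} [DecidableEq ι] (l : E → ι) (S : Finset ι) :
    Ch E →ₗ[ZMod 2] ZMod 2 := Finsupp.linearCombination (ZMod 2) (full l S)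

@[simp] lemma fullL_single {E ι : Type} [DecidableEq ι] (l : E → ι) (S : Finset ι) (τ : List E) :
    fullL l S (Finsupp.single τ 1) = full l S τ := by simp [fullL]

lemma card_lab {E ι : Type} [DecidableEq ι] (l : E → ι) (τ : List E) :
    (τ.map l).toFinset.card ≤ τ.length := by
  simpa using List.toFinset_card_le (τ.map l)

lemma full_cons {E ι : Type} [DecidableEq ι] (l : E → ι) (S : Finset ι) (b : E) (ρ : List E) :
    full l S (b :: ρ) = if l b ∈ S then full l (S.erase (l b)) ρ else 0 := by
  unfold full
  have hc := card_lab l ρ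
  by_cases hb : l b ∈ S
  · rw [if_pos hb]
    have hS := Finset.card_erase_add_one hb
    congr 1
    apply propext
    simp only [List.length_cons, List.map_cons, List.toFinset_cons]
    constructor
    · rintro ⟨h1, h2⟩
      refine ⟨by omega, ?_⟩
      symm
      apply Finset.eq_of_subset_of_card_le
      · intro a ha
        rw [Finset.mem_erase, ← h2, Finset.mem_insert] at ha
        tauto
      · omega
    · rintro ⟨h1, h2⟩
      refine ⟨by omega, ?_⟩
      rw [h2, Finset.insert_erase hb]
  · rw [if_neg hb, if_neg]
    rintro ⟨_, h2⟩
    apply hb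
    rw [← h2]
    simp

lemma fullL_cone {E ι : Type} [DecidableEq ι] (l : E → ι) (S : Finset ι) (b : E) (z : Ch E) :
    fullL l S (cone b z) = if l b ∈ S then fullL l (S.erase (l b)) z else 0 := by
  by_cases hb : l b ∈ S
  · rw [if_pos hb]
    apply lin_ext (fullL l S ∘ₗ cone b) (fullL l (S.erase (l b)))
    intro τ
    simp [full_cons, hb]
  · rw [if_neg hb]
    apply lin_ext (fullL l S ∘ₗ cone b) 0
    intro τ
    simp [full_cons, hb]

lemma full_bd {E ι : Type} [DecidableEq ι] (l : E → ι) (τ : List E) :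
    ∀ S : Finset ι, τ.length = S.card + 1 →
      fullL l S (bdL τ) = if S ⊂ (τ.map l).toFinset then 1 else 0 := by
  induction τ with
  | nil => intro S h; simp at h
  | cons b τ ih =>
    intro S h
    simp only [List.length_cons, add_left_inj] at h
    rw [bdL, map_add, fullL_single, fullL_cone]
    have hc := card_lab l τ
    simp only [List.map_cons, List.toFinset_cons]
    generalize hT : (τ.map l).toFinset = T at *
    have hf : full l S τ = if T = S then 1 else 0 := by simp [full, h, hT]
    rw [hf]
    by_cases hb : l b ∈ S
    · have hS := Finset.card_erase_add_one hb
      rw [if_pos hb, ih _ (by omega)]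
      by_cases hTS : T = S
      · subst hTS
        rw [if_pos rfl, if_pos (Finset.erase_ssubset hb), Finset.insert_eq_of_mem hb, if_neg]
        · decide
        · exact fun h => h.2 (Finset.Subset.refl _)
      · rw [if_neg hTS, zero_add]
        congr 1
        apply propext
        constructor
        · rintro ⟨h1, h2⟩
          have hsub : S ⊆ insert (l b) T := by
            intro a ha
            by_cases hab : a = l b
            · simp [hab]
            · exact Finset.mem_insert_of_mem (h1 (Finset.mem_erase.2 ⟨hab, ha⟩))
          refine ⟨hsub, fun h3 => hTS ?_⟩
          have hTsub : T ⊆ S := fun a ha => h3 (Finset.mem_insert_of_mem ha)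
          apply Finset.eq_of_subset_of_card_le hTsub
          have := Finset.card_lt_card (Finset.ssubset_iff_subset_ne.2 ⟨h1, fun h => h2 h.ge⟩)
          omega
        · rintro ⟨h1, h2⟩
          constructor
          · intro a ha
            have := h1 (Finset.mem_of_mem_erase ha)
            rw [Finset.mem_insert] at this
            rcases this with h | h
            · exact absurd h (Finset.ne_of_mem_erase ha)
            · exact h
          · intro h3
            apply h2
            intro a ha
            rw [Finset.mem_insert] at ha
            rcases ha with rfl | ha
            · exact hb
            · exact Finset.mem_of_mem_erase (h3 ha)
    · rw [if_neg hb, add_zero]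
      congr 1
      apply propext
      constructor
      · rintro rfl
        exact Finset.ssubset_insert hb
      · rintro ⟨h1, h2⟩
        symm
        apply Finset.eq_of_subset_of_card_le
        · intro a ha
          have := h1 ha
          rw [Finset.mem_insert] at this
          rcases this with rfl | h
          · exact absurd ha hb
          · exact h
        · omega

/-! prism -/

noncomputable def topL {E : Type} : Ch E →ₗ[ZMod 2] Ch (E × ℝ) :=
  Finsupp.linearCombination (ZMod 2) (fun τ => Finsupp.single (τ.map (fun p => (p, (1 : ℝ)))) 1)
noncomputable def botL {E : Type} : Ch E →ₗ[ZMod 2] Ch (E × ℝ) :=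
  Finsupp.linearCombination (ZMod 2) (fun τ => Finsupp.single (τ.map (fun p => (p, (0 : ℝ)))) 1)

noncomputable def prL {E : Type} : List E → Ch (E × ℝ)
  | [] => 0
  | p :: τ => Finsupp.single ((p, 0) :: (p, 1) :: τ.map (fun p => (p, (1 : ℝ)))) 1
      + cone (p, 0) (prL τ)

noncomputable def pr {E : Type} : Ch E →ₗ[ZMod 2] Ch (E × ℝ) :=
  Finsupp.linearCombination (ZMod 2) prL

@[simp] lemma pr_single {E : Type} (τ : List E) : pr (Finsupp.single τ 1) = prL τ := by simp [pr]
@[simp] lemma topL_single {E : Type} (τ : List E) :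
  topL (Finsupp.single τ 1) = Finsupp.single (τ.map (fun p => (p, (1 : ℝ)))) 1 := by simp [topL]
@[simp] lemma botL_single {E : Type} (τ : List E) :
  botL (Finsupp.single τ 1) = Finsupp.single (τ.map (fun p => (p, (0 : ℝ)))) 1 := by simp [botL]

lemma topL_cone {E : Type} (b : E) (z : Ch E) : topL (cone b z) = cone (b, 1) (topL z) := by
  apply lin_ext (topL ∘ₗ cone b) (cone (b, 1) ∘ₗ topL)
  intro τ; simp

lemma pr_cone {E : Type} (b : E) (z : Ch E) :
    pr (cone b z) = cone (b, 0) (cone (b, 1) (topL z)) + cone (b, 0) (pr z) := by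
  apply lin_ext (pr ∘ₗ cone b) (cone (b, 0) ∘ₗ cone (b, 1) ∘ₗ topL + cone (b, 0) ∘ₗ pr)
  intro τ; simp [prL]

lemma top_bdL {E : Type} (τ : List E) :
    bdL (τ.map (fun p => (p, (1 : ℝ)))) = topL (bdL τ) := by
  induction τ with
  | nil => simp [bdL]
  | cons b τ ih => simp [bdL, ih, topL_cone]

lemma bd_prL {E : Type} (τ : List E) :
    bd (prL τ) = Finsupp.single (τ.map (fun p => (p, (1 : ℝ)))) 1
      + Finsupp.single (τ.map (fun p => (p, (0 : ℝ)))) 1 + pr (bdL τ) := by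
  induction τ with
  | nil => simp [prL, bdL]; exact (ZModModule.add_self _).symm
  | cons b τ ih =>
    simp only [prL, bdL, map_add, bd_single, bd_cone, ih, pr_single, pr_cone, top_bdL, cone_single,
      List.map_cons]
    generalize cone (b, (0 : ℝ)) (pr (bdL τ)) = a1
    generalize cone (b, (0 : ℝ)) (cone (b, (1 : ℝ)) (topL (bdL τ))) = a2
    generalize prL τ = a3
    generalize hB : (Finsupp.single ((b, (0 : ℝ)) :: List.map (fun p => (p, (1 : ℝ))) τ)
      (1 : ZMod 2)) = B
    have := ZModModule.add_self B
    rw [← sub_eq_zero]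
    abel_nf
    simpa [two_smul] using this

lemma prL_supp {E : Type} (τ : List E) :
    prL τ ∈ supp (fun ρ => ρ.length = τ.length + 1 ∧ ∀ q ∈ ρ, q.1 ∈ τ ∧ q.2 ∈ Set.Icc (0 : ℝ) 1) := by
  induction τ with
  | nil => simp [prL]
  | cons b τ ih =>
    rw [prL]
    refine add_mem (single_supp ?_) (cone_supp _ ?_ ih)
    · simp; grind
    · rintro ρ ⟨h1, h2⟩
      refine ⟨by simp [h1], ?_⟩
      intro q hq
      rcases List.mem_cons.1 hq with rfl | hq
      · simp
      · exact ⟨List.mem_cons_of_mem _ (h2 q hq).1, (h2 q hq).2⟩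

/-! barycentric subdivision -/

/-- boundary of a list of vertices -/
lemma bdL_map_supp {E ι : Type} [DecidableEq ι] (v : ι → E) (js : List ι) (hnd : js.Nodup) :
    bdL (js.map v) ∈ supp (fun ρ => ρ.length + 1 = js.length ∧
      ∃ a ∈ js, ∀ q ∈ ρ, ∃ j ∈ js, j ≠ a ∧ q = v j) := by
  refine supp_mono ?_ (bdL_supp _)
  rintro ρ ⟨h1, h2⟩
  simp only [List.length_map] at h1
  refine ⟨h1, ?_⟩
  obtain ⟨js', hs, rfl⟩ := List.sublist_map_iff.1 h2
  simp only [List.length_map] at h1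
  have : ∃ a ∈ js, a ∉ js' := by
    by_contra hcon
    push Not at hcon
    have := (List.subperm_of_subset hnd hcon).length_le
    omega
  obtain ⟨a, ha, ha'⟩ := this
  refine ⟨a, ha, ?_⟩
  intro q hq
  obtain ⟨j, hj, rfl⟩ := List.mem_map.1 hq
  exact ⟨j, hs.subset hj, fun h => ha' (h ▸ hj), rfl⟩

section sd
variable {E : Type} [NormedAddCommGroup E] [NormedSpace ℝ E]

noncomputable def bary (σ : List E) : E := (σ.length : ℝ)⁻¹ • σ.sum

lemma bary_mem {Q : Set E} (hQ : Convex ℝ Q) {σ : List E} (h0 : σ ≠ []) (h : ∀ q ∈ σ, q ∈ Q) :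
    bary σ ∈ Q := by
  have hl : (σ.length : ℝ) ≠ 0 := by simpa using h0
  have : bary σ = ∑ i : Fin σ.length, (σ.length : ℝ)⁻¹ • σ[i] := by
    rw [bary, ← Finset.smul_sum]
    congr 1
    simp [Fin.sum_univ_getElem]
  rw [this]
  apply hQ.sum_mem
  · intros; positivity
  · simp [hl]
  · intro i _
    exact h _ (List.getElem_mem _)

lemma norm_sum_sub (p : E) (D : ℝ) (σ : List E) (h : ∀ q ∈ σ, dist q p ≤ D) :
    ‖σ.sum - (σ.length : ℝ) • p‖ ≤ σ.length * D := by
  induction σ with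
  | nil => simp
  | cons a σ ih =>
    have h1 := h a (by simp)
    have h2 := ih (fun q hq => h q (by simp [hq]))
    rw [dist_eq_norm] at h1
    have : (a :: σ).sum - ((a :: σ).length : ℝ) • p = (a - p) + (σ.sum - (σ.length : ℝ) • p) := by
      simp only [List.sum_cons, List.length_cons, Nat.cast_add, Nat.cast_one, add_smul, one_smul]
      abel
    rw [this]
    refine (norm_add_le _ _).trans ?_
    simp only [List.length_cons, Nat.cast_add, Nat.cast_one]
    linarith

lemma bary_dist {σ : List E} {D : ℝ} {m : ℕ} (hm : σ.length ≤ m + 1) (hD : 0 ≤ D)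
    (h : ∀ q ∈ σ, ∀ q' ∈ σ, dist q q' ≤ D) {p : E} (hp : p ∈ σ) :
    dist p (bary σ) ≤ (m / (m + 1) : ℝ) * D := by
  obtain ⟨s, t, rfl⟩ := List.append_of_mem hp
  set σ := s ++ p :: t with hσ
  have h1 := norm_sum_sub p D (s ++ t) (fun q hq => h q (by simp at hq; simp [hσ]; tauto) p hp)
  have hlen : (σ.length : ℝ) = (s ++ t).length + 1 := by simp [hσ]; ring
  have hlen' : σ.length = (s ++ t).length + 1 := by simp [hσ]; ring
  have hsum : σ.sum = (s ++ t).sum + p := by simp [hσ]; abel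
  have hpos : (0 : ℝ) < σ.length := by rw [hlen]; positivity
  have e : bary σ - p = (σ.length : ℝ)⁻¹ • ((s ++ t).sum - ((s ++ t).length : ℝ) • p) := by
    have : p = (σ.length : ℝ)⁻¹ • ((σ.length : ℝ) • p) := by
      rw [smul_smul, inv_mul_cancel₀ hpos.ne', one_smul]
    conv_lhs => rw [this]
    rw [bary, ← smul_sub, hsum, hlen, add_smul, one_smul]
    congr 1
    abel
  rw [dist_comm, dist_eq_norm, e, norm_smul, norm_inv, Real.norm_of_nonneg hpos.le]
  have hk : ((s ++ t).length : ℝ) ≤ m := by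
    have : (s ++ t).length ≤ m := by omega
    exact_mod_cast this
  have hk0 : (0 : ℝ) ≤ (s ++ t).length := by positivity
  rw [hlen]
  generalize ((s ++ t).length : ℝ) = k at *
  calc (k + 1)⁻¹ * _ ≤ (k + 1)⁻¹ * (k * D) := by gcongr
    _ = (k / (k + 1)) * D := by ring
    _ ≤ _ := by
      refine mul_le_mul_of_nonneg_right ?_ hD
      rw [div_le_div_iff₀ (by positivity) (by positivity)]
      nlinarith

noncomputable def sd : ℕ → (Ch E →ₗ[ZMod 2] Ch E)
  | 0 => LinearMap.id
  | k + 1 => Finsupp.linearCombination (ZMod 2) (fun σ => cone (bary σ) (sd k (bdL σ)))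

lemma sd_succ_single (k : ℕ) (σ : List E) :
    sd (k + 1) (Finsupp.single σ 1) = cone (bary σ) (sd k (bdL σ)) := by
  simp [sd]

def G (k : ℕ) (Q : Set E) (D : ℝ) (τ : List E) : Prop :=
  τ.length = k ∧ (∀ q ∈ τ, q ∈ Q) ∧ ∀ q ∈ τ, ∀ q' ∈ τ, dist q q' ≤ D

lemma sd_supp {D : ℝ} {m : ℕ} (hD : 0 ≤ D) (k : ℕ) (hk : k ≤ m + 1) :
    ∀ (Q : Set E), Convex ℝ Q → ∀ σ : List E, G k Q D σ →
      sd k (Finsupp.single σ 1) ∈ supp (G k Q ((m / (m + 1) : ℝ) * D)) := by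
  have hr : (0 : ℝ) ≤ (m / (m + 1) : ℝ) * D := by positivity
  induction k with
  | zero =>
    rintro Q hQ σ ⟨h1, h2, h3⟩
    obtain rfl : σ = [] := by simpa using h1
    exact single_supp (by simp [G])
  | succ k ih =>
    rintro Q hQ σ ⟨h1, h2, h3⟩
    rw [sd_succ_single]
    have hne : σ ≠ [] := by rintro rfl; simp at h1
    have hb : sd k (bdL σ) ∈
        supp (G k (convexHull ℝ {q | q ∈ σ}) ((m / (m + 1) : ℝ) * D)) := by
      refine map_supp _ (sd k) ?_ (bdL_supp σ)
      rintro τ ⟨t1, t2⟩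
      apply ih (by omega) _ (convex_convexHull ℝ _)
      refine ⟨by omega, fun q hq => subset_convexHull ℝ _ (t2.subset hq), ?_⟩
      exact fun q hq q' hq' => h3 q (t2.subset hq) q' (t2.subset hq')
    have hball : convexHull ℝ {q | q ∈ σ} ⊆ Metric.closedBall (bary σ) ((m / (m + 1) : ℝ) * D) := by
      apply convexHull_min _ (convex_closedBall _ _)
      intro p hp
      exact bary_dist (by omega) hD h3 hp
    have hsub : convexHull ℝ {q | q ∈ σ} ⊆ Q := convexHull_min h2 hQ
    refine cone_supp _ ?_ hb
    rintro τ ⟨t1, t2, t3⟩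
    refine ⟨by simp [t1], ?_, ?_⟩
    · intro q hq
      rcases List.mem_cons.1 hq with rfl | hq
      · exact bary_mem hQ hne h2
      · exact hsub (t2 q hq)
    · intro q hq q' hq'
      rcases List.mem_cons.1 hq with rfl | hq <;> rcases List.mem_cons.1 hq' with rfl | hq'
      · simpa using hr
      · rw [dist_comm]; exact hball (t2 _ hq')
      · exact hball (t2 _ hq)
      · exact t3 _ hq _ hq'

lemma sd_bd (k : ℕ) : ∀ z : Ch E, z ∈ supp (fun τ : List E => τ.length = k) →
    bd (sd k z) = sd (k - 1) (bd z) := by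
  induction k with
  | zero =>
    intro z hz
    have h0 : (sd 0 : Ch E →ₗ[ZMod 2] Ch E) = LinearMap.id := rfl
    rw [Nat.zero_sub, h0, LinearMap.id_apply, LinearMap.id_apply]
  | succ k ih =>
    intro z hz
    rw [Nat.add_sub_cancel]
    have hh : ∀ τ : List E, τ.length = k + 1 → (bd ∘ₗ sd (k + 1)) (Finsupp.single τ 1) =
        (sd k ∘ₗ bd) (Finsupp.single τ 1) := by
      intro τ ht
      rw [LinearMap.comp_apply, LinearMap.comp_apply, sd_succ_single, bd_cone, bd_single, ih,
        bd_bdL, map_zero, map_zero, add_zero]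
      refine supp_mono ?_ (bdL_supp τ)
      rintro ρ ⟨h, _⟩
      omega
    have := eq_on_supp _ _ hh hz
    rwa [LinearMap.comp_apply, LinearMap.comp_apply] at this

lemma sdN_supp {D : ℝ} {m : ℕ} (hD : 0 ≤ D) (k : ℕ) (hk : k ≤ m + 1) (Q : Set E)
    (hQ : Convex ℝ Q) (N : ℕ) {z : Ch E} (hz : z ∈ supp (G k Q D)) :
    ((sd k) ^ N) z ∈ supp (G k Q ((m / (m + 1) : ℝ) ^ N * D)) := by
  induction N with
  | zero => simpa using hz
  | succ N ih =>
    rw [pow_succ' (sd k), Module.End.mul_apply]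
    refine map_supp _ (sd k) ?_ ih
    intro τ ht
    have := sd_supp (m := m) (D := (m / (m + 1) : ℝ) ^ N * D) (by positivity) k hk Q hQ τ ht
    rwa [pow_succ', mul_assoc]

/-- version without distances -/
lemma sdN_supp' (k : ℕ) (Q : Set E) (hQ : Convex ℝ Q) (N : ℕ) {σ : List E}
    (h1 : σ.length = k) (h2 : ∀ q ∈ σ, q ∈ Q) :
    ((sd k) ^ N) (Finsupp.single σ 1) ∈ supp (fun τ => τ.length = k ∧ ∀ q ∈ τ, q ∈ Q) := by
  obtain ⟨D, hD⟩ := Metric.isBounded_iff.1 (Set.Finite.isBounded (List.finite_toSet σ))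
  have := sdN_supp (D := max D 0) (m := k) (le_max_right _ _) k (by omega) Q hQ N
    (single_supp (τ := σ) (p := G k Q (max D 0))
      ⟨h1, h2, fun q hq q' hq' => (hD hq hq').trans (le_max_left _ _)⟩)
  exact supp_mono (fun τ ht => ⟨ht.1, ht.2.1⟩) this

lemma sdN_len (k : ℕ) (N : ℕ) {z : Ch E} (hz : z ∈ supp (fun τ : List E => τ.length = k)) :
    ((sd k) ^ N) z ∈ supp (fun τ : List E => τ.length = k) := by
  refine map_supp _ _ ?_ hz
  intro τ ht
  exact supp_mono (fun τ ht => ht.1) (sdN_supp' k Set.univ convex_univ N ht (by simp))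

lemma sdN_bd (k N : ℕ) {z : Ch E} (hz : z ∈ supp (fun τ : List E => τ.length = k)) :
    bd (((sd k) ^ N) z) = ((sd (k - 1)) ^ N) (bd z) := by
  induction N with
  | zero => simp
  | succ N ih =>
    rw [pow_succ', Module.End.mul_apply, sd_bd _ _ (sdN_len k N hz), ih, pow_succ',
      Module.End.mul_apply]

/-- Sperner -/
lemma sperner {ι : Type} [DecidableEq ι] (l : E → ι) (v : ι → E) (S0 : Finset ι)
    (Q : Finset ι → Set E) (hQ : ∀ S, Convex ℝ (Q S)) (hv : ∀ S, ∀ j ∈ S, v j ∈ Q S)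
    (hl : ∀ S ⊆ S0, ∀ q ∈ Q S, l q ∈ S) (N : ℕ) (js : List ι) :
    js.Nodup → js.toFinset ⊆ S0 →
      fullL l js.toFinset (((sd js.length) ^ N) (Finsupp.single (js.map v) 1)) = 1 := by
  induction js with
  | nil =>
    intro _ _
    have : ((sd 0 : Ch E →ₗ[ZMod 2] Ch E) ^ N) = 1 := by
      have : (sd 0 : Ch E →ₗ[ZMod 2] Ch E) = 1 := rfl
      rw [this, one_pow]
    simp [this, full]
  | cons j js ih =>
    intro hnd hS
    have hj : j ∉ js := (List.nodup_cons.1 hnd).1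
    have hnd' := (List.nodup_cons.1 hnd).2
    set S := js.toFinset with hSdef
    have hjS : j ∉ S := by simpa [hSdef] using hj
    have hcard : S.card = js.length := List.toFinset_card_of_nodup hnd'
    rw [List.toFinset_cons] at hS ⊢
    rw [← hSdef] at hS ⊢
    have ih := ih hnd' (fun a ha => hS (Finset.mem_insert_of_mem ha))
    set k := js.length with hk
    have hlen : (j :: js).length = k + 1 := by simp [hk]
    rw [hlen]
    have hz := sdN_supp' (k + 1) (Q (insert j S)) (hQ _) N (σ := (j :: js).map v) (by simp [hk]) (by
      intro q hq
      obtain ⟨a, ha, rfl⟩ := List.mem_map.1 hq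
      apply hv
      simpa [hSdef] using ha)
    have key : ∀ z ∈ supp (fun τ : List E => τ.length = k + 1 ∧ ∀ q ∈ τ, q ∈ Q (insert j S)),
        fullL l (insert j S) z = fullL l S (bd z) := by
      intro z hz
      refine eq_on_supp (fullL l (insert j S)) (fullL l S ∘ₗ bd) ?_ hz
      rintro τ ⟨h1, h2⟩
      rw [fullL_single, LinearMap.comp_apply, bd_single, full_bd _ _ _ (by omega), full]
      congr 1
      apply propext
      have hsub : (τ.map l).toFinset ⊆ insert j S := by
        intro a ha
        obtain ⟨q, hq, rfl⟩ := List.mem_map.1 (List.mem_toFinset.1 ha)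
        exact hl _ hS _ (h2 q hq)
      have hci : (insert j S).card = S.card + 1 := Finset.card_insert_of_notMem hjS
      constructor
      · rintro ⟨_, h⟩
        rw [h]
        exact Finset.ssubset_insert hjS
      · intro h
        refine ⟨by omega, Finset.eq_of_subset_of_card_le hsub ?_⟩
        have := Finset.card_lt_card h
        omega
    rw [key _ hz, sdN_bd _ _ (single_supp (by simp [hk])), bd_single, Nat.add_sub_cancel,
      List.map_cons, bdL, map_add, map_add, ih]
    have hzero : fullL l S (((sd k) ^ N) (cone (v j) (bdL (js.map v)))) ∈
        (⊥ : Submodule (ZMod 2) (ZMod 2)) := by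
      refine map_supp (p := fun ρ => ρ.length = k ∧ ∃ a ∈ S, ∀ q ∈ ρ, ∃ i ∈ insert j S,
        i ≠ a ∧ q = v i) ⊥ (fullL l S ∘ₗ ((sd k) ^ N)) ?_ (cone_supp (v j) ?_ (bdL_map_supp v js hnd'))
      · rintro τ ⟨h1, a, ha, h2⟩
        have h3 := sdN_supp' k (Q ((insert j S).erase a)) (hQ _) N (σ := τ) h1 (by
          intro q hq
          obtain ⟨i, hi, hia, rfl⟩ := h2 q hq
          exact hv _ _ (Finset.mem_erase.2 ⟨hia, hi⟩))
        refine map_supp ⊥ (fullL l S) ?_ h3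
        rintro ρ ⟨r1, r2⟩
        rw [fullL_single, full, if_neg]
        · simp
        · rintro ⟨_, r3⟩
          rw [← r3] at ha
          obtain ⟨q, hq, rfl⟩ := List.mem_map.1 (List.mem_toFinset.1 ha)
          have := hl _ ((Finset.erase_subset _ _).trans hS) _ (r2 q hq)
          simp at this
      · rintro τ ⟨h1, a, ha, h2⟩
        refine ⟨by simp [h1, hk], a, by simpa [hSdef] using ha, ?_⟩
        intro q hq
        rcases List.mem_cons.1 hq with rfl | hq
        · exact ⟨j, by simp, fun h => hj (h ▸ ha), rfl⟩
        · obtain ⟨i, hi, hia, rfl⟩ := h2 q hq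
          exact ⟨i, by simp [hSdef, hi], hia, rfl⟩
    rw [Submodule.mem_bot] at hzero
    rw [hzero, add_zero]

end sd

/-! the core argument -/

def XX (n : ℕ) (c : Fin (n + 1)) : Set ((Fin (n + 1) → ℝ) × ℝ) :=
  {q | q.1 ∈ stdSimplex ℝ (Fin (n + 1)) ∧ q.1 c = 0 ∧ q.2 ∈ Set.Icc (0 : ℝ) 1}

lemma XX_conv (n : ℕ) (c : Fin (n + 1)) : Convex ℝ (XX n c) := by
  rintro ⟨p, s⟩ ⟨h1, h2, h3⟩ ⟨p', s'⟩ ⟨h1', h2', h3'⟩ a b ha hb hab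
  refine ⟨convex_stdSimplex ℝ _ h1 h1' ha hb hab, ?_, convex_Icc 0 1 h3 h3' ha hb hab⟩
  simp at h2 h2'
  simp [h2, h2']

lemma XX_compact (n : ℕ) (c : Fin (n + 1)) : IsCompact (XX n c) := by
  have h1 : IsCompact (stdSimplex ℝ (Fin (n + 1)) ×ˢ Set.Icc (0 : ℝ) 1) :=
    (isCompact_stdSimplex ℝ _).prod isCompact_Icc
  have : XX n c = (stdSimplex ℝ (Fin (n + 1)) ×ˢ Set.Icc (0 : ℝ) 1) ∩ {q | q.1 c = 0} := by
    ext q; simp [XX]; tauto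
  rw [this]
  apply h1.inter_right
  exact isClosed_eq (by fun_prop) continuous_const

noncomputable def hd {E : Type} (f : E → ZMod 2) : List E → ZMod 2
  | [] => 0
  | q :: _ => f q

noncomputable def LL {n : ℕ} {E : Type} (l : E → Fin (n + 1)) (Φ : Fin (n + 1) → E → ZMod 2) :
    Ch E →ₗ[ZMod 2] ZMod 2 :=
  Finsupp.linearCombination (ZMod 2) (fun τ => ∑ d, full l {d}ᶜ τ * hd (Φ d) τ)

lemma LL_single {n : ℕ} {E : Type} (l : E → Fin (n + 1)) (Φ : Fin (n + 1) → E → ZMod 2)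
    (τ : List E) : LL l Φ (Finsupp.single τ 1) = ∑ d, full l {d}ᶜ τ * hd (Φ d) τ := by
  simp [LL]

lemma full_mul_hd {E ι : Type} [DecidableEq ι] (l : E → ι) (S : Finset ι) (hS : S.Nonempty)
    (τ : List E) (f : E → ZMod 2) (w : ZMod 2)
    (h : (τ.map l).toFinset = S → ∀ q ∈ τ, f q = w) :
    full l S τ * hd f τ = w * full l S τ := by
  by_cases hf : τ.length = S.card ∧ (τ.map l).toFinset = S
  · have h' := h hf.2
    cases τ with
    | nil =>
      have := hf.2
      simp at this
      exact absurd this.symm hS.ne_empty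
    | cons q τ =>
      rw [hd, h' q (by simp), mul_comm]
  · simp [full, hf]

lemma LL_small {n : ℕ} (hn : 1 ≤ n) {E : Type} (l : E → Fin (n + 1))
    (Φ : Fin (n + 1) → E → ZMod 2) (τ : List E) (hτ : τ.length = n + 1)
    (w : Fin (n + 1) → ZMod 2) (T : Finset (Fin (n + 1))) (hT : ∀ q ∈ τ, l q ∈ T)
    (hw : ∀ d, {d}ᶜ ⊆ T → ∀ q ∈ τ, Φ d q = w d) (hs : T = Finset.univ → ∑ d, w d = 0) :
    LL l Φ (bdL τ) = 0 := by
  have hcard : ∀ d : Fin (n + 1), ({d}ᶜ : Finset (Fin (n + 1))).card = n := by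
    intro d; simp [Finset.card_compl]
  have e : LL l Φ (bdL τ) = (∑ d, w d • fullL l {d}ᶜ) (bdL τ) := by
    refine eq_on_supp _ _ ?_ (bdL_supp τ)
    rintro ρ ⟨h1, h2⟩
    rw [LL_single]
    simp only [LinearMap.sum_apply, LinearMap.smul_apply, fullL_single, smul_eq_mul]
    refine Finset.sum_congr rfl fun d _ => ?_
    apply full_mul_hd
    · rw [← Finset.card_pos, hcard]; omega
    · intro hl q hq
      refine hw d ?_ q (h2.subset hq)
      rw [← hl]
      intro a ha
      obtain ⟨q, hq, rfl⟩ := List.mem_map.1 (List.mem_toFinset.1 ha)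
      exact hT q (h2.subset hq)
  rw [e]
  simp only [LinearMap.sum_apply, LinearMap.smul_apply, smul_eq_mul]
  have e2 : ∀ d, fullL l {d}ᶜ (bdL τ) = if (τ.map l).toFinset = Finset.univ then 1 else 0 := by
    intro d
    rw [full_bd _ _ _ (by rw [hcard, hτ])]
    congr 1
    apply propext
    constructor
    · intro h
      have := Finset.card_lt_card h
      rw [hcard] at this
      rw [← Finset.card_eq_iff_eq_univ]
      have h2 := Finset.card_le_univ (τ.map l).toFinset
      simp at h2 ⊢
      omega
    · intro h
      rw [h, Finset.ssubset_univ_iff]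
      intro h
      have := hcard d
      rw [h] at this
      simp at this
  simp only [e2]
  split_ifs with h
  · simp only [mul_one]
    apply hs
    rw [Finset.eq_univ_iff_forall]
    intro a
    have : a ∈ (τ.map l).toFinset := by rw [h]; simp
    obtain ⟨q, hq, rfl⟩ := List.mem_map.1 (List.mem_toFinset.1 this)
    exact hT q hq
  · simp

theorem core {n : ℕ} (hn : 1 ≤ n) (c : Fin (n + 1))
    (l : (Fin (n + 1) → ℝ) × ℝ → Fin (n + 1))
    (Φ : Fin (n + 1) → (Fin (n + 1) → ℝ) × ℝ → ZMod 2) (δ : ℝ) (hδ : 0 < δ)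
    (H1 : ∀ q ∈ XX n c, (q.2 = 0 ∨ q.2 = 1 ∨ ∃ j, j ≠ c ∧ q.1 j = 0) → q.1 (l q) ≠ 0)
    (H2 : ∀ A ⊆ XX n c, A.Nonempty → (∀ q ∈ A, ∀ q' ∈ A, dist q q' < δ) →
      ∃ (w : Fin (n + 1) → ZMod 2) (T : Finset (Fin (n + 1))), (∀ q ∈ A, l q ∈ T) ∧
        (∀ d, {d}ᶜ ⊆ T → ∀ q ∈ A, Φ d q = w d) ∧ (T = Finset.univ → ∑ d, w d = 0))
    (u : ℝ → ZMod 2)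
    (H3 : ∀ s, s = 0 ∨ s = 1 → ∀ A ⊆ XX n c, (∀ q ∈ A, q.2 = s) →
      (∀ q ∈ A, ∀ q' ∈ A, dist q q' < δ) → (∀ j, j ≠ c → ∃ q ∈ A, l q = j) →
      ∀ q ∈ A, Φ c q = u s) : u 0 = u 1 := by
  obtain ⟨D0, hD0⟩ := Metric.isBounded_iff.1 (XX_compact n c).isBounded
  set D := max D0 0 with hDdef
  have hD : 0 ≤ D := le_max_right _ _
  have hXD : ∀ q ∈ XX n c, ∀ q' ∈ XX n c, dist q q' ≤ D :=
    fun q hq q' hq' => (hD0 hq hq').trans (le_max_left _ _)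
  obtain ⟨N, hN⟩ : ∃ N : ℕ, ((n : ℝ) / (n + 1)) ^ N * D < δ := by
    have hr : ((n : ℝ) / (n + 1)) < 1 := by
      rw [div_lt_one (by positivity)]; linarith
    have h1 := tendsto_pow_atTop_nhds_zero_of_lt_one (r := ((n : ℝ) / (n + 1))) (by positivity) hr
    have h2 := h1.mul_const D
    rw [zero_mul] at h2
    exact (h2.eventually (gt_mem_nhds hδ)).exists
  set js : List (Fin (n + 1)) := ({c}ᶜ : Finset (Fin (n + 1))).toList with hjs
  have hnd : js.Nodup := Finset.nodup_toList _
  have hjsF : js.toFinset = {c}ᶜ := by simp [hjs]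
  have hmem : ∀ j, j ∈ js ↔ j ≠ c := by intro j; simp [hjs]
  have hlen : js.length = n := by simp [hjs, Finset.card_compl]
  let e : Fin (n + 1) → Fin (n + 1) → ℝ := fun j => Pi.single j 1
  have he : ∀ j, e j ∈ stdSimplex ℝ (Fin (n + 1)) := fun j => single_mem_stdSimplex ℝ j
  have he0 : ∀ j a, a ≠ j → e j a = 0 := fun j a h => by simp [e, h]
  -- the ends
  have bot : ∀ s, s = 0 ∨ s = 1 → LL l Φ (((sd n) ^ N)
      (Finsupp.single ((js.map e).map (fun p => (p, s))) 1)) = u s := by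
    intro s hs
    have hsI : s ∈ Set.Icc (0 : ℝ) 1 := by rcases hs with rfl | rfl <;> simp
    let Q : Finset (Fin (n + 1)) → Set ((Fin (n + 1) → ℝ) × ℝ) := fun S =>
      {q | q.1 ∈ stdSimplex ℝ (Fin (n + 1)) ∧ (∀ j, j ∉ S → q.1 j = 0) ∧ q.2 = s}
    have hQ : ∀ S, Convex ℝ (Q S) := by
      rintro S ⟨p, t⟩ ⟨h1, h2, h3⟩ ⟨p', t'⟩ ⟨h1', h2', h3'⟩ a b ha hb hab
      refine ⟨convex_stdSimplex ℝ _ h1 h1' ha hb hab, ?_, ?_⟩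
      · intro j hj
        have g1 := h2 j hj
        have g2 := h2' j hj
        simp at g1 g2
        simp [g1, g2]
      · simp at h3 h3'
        simp [h3, h3', ← add_mul, hab]
    have hQX : ∀ S ⊆ ({c}ᶜ : Finset (Fin (n + 1))), Q S ⊆ XX n c := by
      rintro S hS q ⟨h1, h2, h3⟩
      refine ⟨h1, h2 c (fun h => by simpa using hS h), h3 ▸ hsI⟩
    have hsp := sperner l (fun j => (e j, s)) ({c}ᶜ) Q hQ
      (fun S j hj => ⟨he j, fun a ha => he0 j a (fun h => ha (h ▸ hj)), rfl⟩)
      (fun S hS q hq => by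
        by_contra hcon
        exact H1 q (hQX S hS hq) (by rw [hq.2.2]; tauto) (hq.2.1 _ hcon)) N js hnd hjsF.subset
    rw [hlen, hjsF] at hsp
    have hG := sdN_supp (m := n) hD n (by omega) (Q {c}ᶜ) (hQ _) N
      (single_supp (τ := js.map (fun j => (e j, s))) (p := G n (Q {c}ᶜ) D) (by
        have hin : ∀ q ∈ js.map (fun j => (e j, s)), q ∈ Q {c}ᶜ := by
          intro q hq
          obtain ⟨j, hj, rfl⟩ := List.mem_map.1 hq
          refine ⟨he j, fun a ha => he0 j a ?_, rfl⟩
          rintro rfl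
          exact ha (by simpa using (hmem a).1 hj)
        refine ⟨by simp [hlen], hin, fun q hq q' hq' => hXD _ ?_ _ ?_⟩
        · exact hQX _ subset_rfl (hin q hq)
        · exact hQX _ subset_rfl (hin q' hq')))
    have heq : LL l Φ (((sd n) ^ N) (Finsupp.single (js.map (fun j => (e j, s))) 1)) =
        (u s • fullL l {c}ᶜ) (((sd n) ^ N) (Finsupp.single (js.map (fun j => (e j, s))) 1)) := by
      refine eq_on_supp _ _ ?_ hG
      rintro τ ⟨t1, t2, t3⟩
      rw [LL_single, LinearMap.smul_apply, fullL_single, smul_eq_mul]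
      rw [Finset.sum_eq_single c]
      · apply full_mul_hd
        · rw [← Finset.card_pos]; simp [Finset.card_compl]; omega
        · intro hl q hq
          refine H3 s hs {q | q ∈ τ} (fun q hq => hQX _ subset_rfl (t2 q hq))
            (fun q hq => (t2 q hq).2.2) (fun q hq q' hq' => (t3 q hq q' hq').trans_lt hN) ?_ q hq
          intro j hj
          have : j ∈ (τ.map l).toFinset := by rw [hl]; simpa using hj
          obtain ⟨q, hq, rfl⟩ := List.mem_map.1 (List.mem_toFinset.1 this)
          exact ⟨q, hq, rfl⟩
      · intro d _ hd
        rw [full, if_neg, zero_mul]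
        rintro ⟨_, hl⟩
        have : c ∈ (τ.map l).toFinset := by rw [hl]; simpa using hd.symm
        obtain ⟨q, hq, hqc⟩ := List.mem_map.1 (List.mem_toFinset.1 this)
        refine H1 q (hQX _ subset_rfl (t2 q hq)) (by rw [(t2 q hq).2.2]; tauto) ?_
        rw [hqc]
        exact (t2 q hq).2.1 c (by simp)
      · simp
    rw [List.map_map]
    change LL l Φ (((sd n) ^ N) (Finsupp.single (js.map (fun j => (e j, s))) 1)) = u s
    rw [heq, LinearMap.smul_apply, hsp, smul_eq_mul, mul_one]
  -- the sides
  have side : LL l Φ (((sd n) ^ N) (pr (bdL (js.map e)))) = 0 := by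
    have : LL l Φ (((sd n) ^ N) (pr (bdL (js.map e)))) ∈ (⊥ : Submodule (ZMod 2) (ZMod 2)) := by
      refine map_supp ⊥ (LL l Φ ∘ₗ ((sd n) ^ N) ∘ₗ pr) ?_ (bdL_map_supp e js hnd)
      rintro ρ ⟨h1, a, ha, h2⟩
      rw [LinearMap.comp_apply, LinearMap.comp_apply, pr_single]
      refine map_supp ⊥ (LL l Φ ∘ₗ ((sd n) ^ N)) ?_ (prL_supp ρ)
      rintro σ ⟨s1, s2⟩
      rw [LinearMap.comp_apply]
      let Q : Set ((Fin (n + 1) → ℝ) × ℝ) := {q | q ∈ XX n c ∧ q.1 a = 0}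
      have hQ : Convex ℝ Q := by
        rintro q ⟨h1, h2⟩ q' ⟨h1', h2'⟩ b b' hb hb' hbb
        refine ⟨XX_conv n c h1 h1' hb hb' hbb, ?_⟩
        simp [h2, h2']
      refine map_supp ⊥ (LL l Φ) ?_ (sdN_supp' n Q hQ N (σ := σ) (by omega) ?_)
      · rintro τ ⟨t1, t2⟩
        rw [LL_single, Finset.sum_eq_zero]
        · simp
        · intro d _
          rw [full, if_neg, zero_mul]
          rintro ⟨_, hl⟩
          have hlab : ∀ b, b = a ∨ b = c → b ∉ (τ.map l).toFinset := by
            intro b hb hmem'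
            obtain ⟨q, hq, rfl⟩ := List.mem_map.1 (List.mem_toFinset.1 hmem')
            refine H1 q (t2 q hq).1 (Or.inr (Or.inr ⟨a, (hmem a).1 ha, (t2 q hq).2⟩)) ?_
            rcases hb with hb | hb
            · rw [hb]; exact (t2 q hq).2
            · rw [hb]; exact (t2 q hq).1.2.1
          rw [hl] at hlab
          have g1 := hlab a (Or.inl rfl)
          have g2 := hlab c (Or.inr rfl)
          simp at g1 g2
          exact (hmem a).1 ha (g1.trans g2.symm)
      · intro q hq
        obtain ⟨hq1, hq2⟩ := s2 q hq
        obtain ⟨j, hj, hja, hje⟩ := h2 _ hq1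
        refine ⟨⟨hje ▸ he j, ?_, hq2⟩, ?_⟩
        · rw [hje]; exact he0 _ _ ((hmem j).1 hj).symm
        · rw [hje]; exact he0 _ _ hja.symm
    simpa using this
  -- the prism
  have hP : prL (js.map e) ∈ supp (G (n + 1) (XX n c) D) := by
    refine supp_mono ?_ (prL_supp _)
    rintro ρ ⟨h1, h2⟩
    have hin : ∀ q ∈ ρ, q ∈ XX n c := by
      intro q hq
      obtain ⟨hq1, hq2⟩ := h2 q hq
      obtain ⟨j, hj, hje⟩ := List.mem_map.1 hq1
      exact ⟨hje ▸ he j, hje ▸ he0 _ _ ((hmem j).1 hj).symm, hq2⟩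
    exact ⟨by simpa [hlen] using h1, hin, fun q hq q' hq' => hXD _ (hin q hq) _ (hin q' hq')⟩
  have hz := sdN_supp (m := n) hD (n + 1) le_rfl (XX n c) (XX_conv n c) N hP
  have hzero : LL l Φ (bd (((sd (n + 1)) ^ N) (prL (js.map e)))) = 0 := by
    refine eq_on_supp (LL l Φ ∘ₗ bd) 0 ?_ hz
    rintro τ ⟨t1, t2, t3⟩
    rw [LinearMap.comp_apply, bd_single, LinearMap.zero_apply]
    obtain ⟨w, T, hT, hw, hs⟩ := H2 {q | q ∈ τ} t2 (by
      cases τ with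
      | nil => simp at t1
      | cons a τ => exact ⟨a, by simp⟩) (fun q hq q' hq' => (t3 q hq q' hq').trans_lt hN)
    exact LL_small hn l Φ τ t1 w T hT hw hs
  rw [sdN_bd _ _ (supp_mono (fun τ ht => ht.1) hP), bd_prL, Nat.add_sub_cancel, map_add, map_add,
    map_add, map_add, side, add_zero, bot 1 (Or.inr rfl), bot 0 (Or.inl rfl)] at hzero
  have := eq_neg_of_add_eq_zero_left hzero
  rw [ZModModule.neg_eq_self] at this
  exact this.symm

end SpChain

namespace PCG

open SpChain

lemma exists_cochain {n : ℕ} {V : Type} [DecidableEq V] (Γ : PCG n V) (c : Fin (n + 1)) (a b : V)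
    (h : Γ.reach {c}ᶜ a b) : ∃ φ : Fin (n + 1) → V → ZMod 2, (∀ d v, φ d (Γ.inv d v) = φ d v) ∧
      (∀ v, φ c v = 0) ∧
      ∀ v, ∑ d, φ d v = (if v = a then 1 else 0) + (if v = b then 1 else 0) := by
  induction h with
  | refl =>
    refine ⟨fun _ _ => 0, by simp, by simp, fun v => ?_⟩
    rw [ZModModule.add_self]
    simp
  | @tail b b' _ hs ih =>
    obtain ⟨φ, h1, h2, h3⟩ := ih
    obtain ⟨d, hd, rfl⟩ := hs
    refine ⟨fun d' v => φ d' v + if d' = d then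
      ((if v = b then 1 else 0) + (if v = Γ.inv d b then 1 else 0)) else 0, ?_, ?_, ?_⟩
    · intro d' v
      simp only [h1]
      by_cases hdd : d' = d
      · subst hdd
        have e1 : (Γ.inv d' v = b) ↔ (v = Γ.inv d' b) :=
          ⟨fun h => by rw [← h, Γ.involutive d' v], fun h => by rw [h, Γ.involutive d' b]⟩
        have e2 : (Γ.inv d' v = Γ.inv d' b) ↔ (v = b) := (Γ.involutive d').injective.eq_iff
        simp only [e1, e2, if_true]
        rw [add_comm (if v = Γ.inv d' b then (1 : ZMod 2) else 0)]
      · simp [hdd]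
    · intro v
      have : c ≠ d := fun h => hd (by simp [h])
      simp [h2, this]
    · intro v
      simp only [Finset.sum_add_distrib, h3, Finset.sum_ite_eq', Finset.mem_univ, if_true]
      generalize (if v = a then (1 : ZMod 2) else 0) = A
      generalize (if v = b then (1 : ZMod 2) else 0) = B
      generalize (if v = Γ.inv d b then (1 : ZMod 2) else 0) = C
      have := ZModModule.add_self B
      linear_combination this

variable {n : ℕ} {V : Type} (Γ : PCG n V)

def mkp (v : V) (t : stdSimplex ℝ (Fin (n + 1))) : Γ.RealSp Set.univ :=
  Quot.mk _ ⟨⟨v, trivial⟩, t⟩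

lemma mkp_continuous (v : V) : Continuous (Γ.mkp v) :=
  continuous_quot_mk.comp continuous_sigmaMk

lemma mkp_step (v : V) (c : Fin (n + 1)) (t : stdSimplex ℝ (Fin (n + 1)))
    (h : (t : Fin (n + 1) → ℝ) c = 0) : Γ.mkp v t = Γ.mkp (Γ.inv c v) t :=
  Quot.sound ⟨c, rfl, rfl, h⟩

lemma mkp_reach (B : Set (Fin (n + 1))) (v w : V) (h : Γ.reach B v w)
    (t : stdSimplex ℝ (Fin (n + 1))) (ht : ∀ c ∈ B, (t : Fin (n + 1) → ℝ) c = 0) :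
    Γ.mkp v t = Γ.mkp w t := by
  induction h with
  | refl => rfl
  | tail _ hs ih =>
    obtain ⟨d, hd, rfl⟩ := hs
    rw [ih, Γ.mkp_step _ d t (ht d hd)]

def coord : Γ.RealSp Set.univ → Fin (n + 1) → ℝ :=
  Quot.lift (fun a => (a.2 : Fin (n + 1) → ℝ)) (by
    rintro a b ⟨c, _, h, _⟩
    simp only [h])

lemma coord_continuous : Continuous Γ.coord :=
  continuous_quot_lift _ (continuous_sigma fun _ => continuous_subtype_val)

@[simp] lemma coord_mkp (v : V) (t : stdSimplex ℝ (Fin (n + 1))) : Γ.coord (Γ.mkp v t) = t := rfl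

lemma coord_mem (p : Γ.RealSp Set.univ) : Γ.coord p ∈ stdSimplex ℝ (Fin (n + 1)) := by
  induction p using Quot.ind with
  | mk a => exact a.2.2

open Classical in
noncomputable def phi (φ : Fin (n + 1) → V → ZMod 2) (hφ : ∀ d v, φ d (Γ.inv d v) = φ d v)
    (d : Fin (n + 1)) : Γ.RealSp Set.univ → ZMod 2 :=
  Quot.lift (fun a => if ∀ j, j ≠ d → 0 < (a.2 : Fin (n + 1) → ℝ) j then φ d a.1 else 0) (by
    rintro a b ⟨c, h1, h2, h3⟩
    simp only [h1, h2]
    by_cases hcd : c = d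
    · subst hcd
      rw [hφ]
    · rw [if_neg, if_neg]
      · intro h
        exact (h c hcd).ne' h3
      · intro h
        exact (h c hcd).ne' h3)

lemma phi_mkp (φ : Fin (n + 1) → V → ZMod 2) (hφ : ∀ d v, φ d (Γ.inv d v) = φ d v)
    (d : Fin (n + 1)) (v : V) (t : stdSimplex ℝ (Fin (n + 1)))
    (h : ∀ j, j ≠ d → 0 < (t : Fin (n + 1) → ℝ) j) : Γ.phi φ hφ d (Γ.mkp v t) = φ d v := by
  simp only [phi, mkp]
  exact if_pos h

lemma isOpen_phi (φ : Fin (n + 1) → V → ZMod 2) (hφ : ∀ d v, φ d (Γ.inv d v) = φ d v)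
    (d : Fin (n + 1)) (k : ZMod 2) :
    IsOpen {p | Γ.phi φ hφ d p = k ∧ ∀ j, j ≠ d → 0 < Γ.coord p j} := by
  rw [← isQuotientMap_quot_mk.isOpen_preimage, isOpen_sigma_iff]
  rintro ⟨v, hv⟩
  have hop : IsOpen {t : stdSimplex ℝ (Fin (n + 1)) | ∀ j, j ≠ d →
      0 < (t : Fin (n + 1) → ℝ) j} := by
    simp only [Set.ofPred_forall]
    refine isOpen_iInter_of_finite fun j => isOpen_iInter_of_finite fun _ => ?_
    exact isOpen_lt continuous_const ((continuous_apply j).comp continuous_subtype_val)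
  by_cases hk : φ d v = k
  · convert hop using 1
    ext t
    constructor
    · rintro ⟨_, h⟩
      exact h
    · intro h
      exact ⟨(Γ.phi_mkp φ hφ d v t h).trans hk, h⟩
  · convert isOpen_empty using 1
    ext t
    simp only [Set.mem_empty_iff_false, iff_false]
    rintro ⟨h1, h2⟩
    exact hk ((Γ.phi_mkp φ hφ d v t h2).symm.trans h1)

lemma exists_lab (t : Fin (n + 1) → ℝ) : ∃ i, ∀ j, t j ≤ t i := Finite.exists_max t

noncomputable def lab (t : Fin (n + 1) → ℝ) : Fin (n + 1) := (exists_lab t).choose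

lemma lab_ge (t : Fin (n + 1) → ℝ) (ht : t ∈ stdSimplex ℝ (Fin (n + 1))) :
    (1 : ℝ) / (n + 1) ≤ t (lab t) := by
  have h := (exists_lab t).choose_spec
  have h2 := ht.2
  have h3 : ∑ j, t j ≤ ∑ _j : Fin (n + 1), t (lab t) := Finset.sum_le_sum fun j _ => h j
  rw [h2] at h3
  simp at h3
  rw [div_le_iff₀ (by positivity)]
  linarith

lemma exists_homotopy (e : Γ.RealSp Set.univ ≃ₜ sphereType n) (c : Fin (n + 1)) (x y : V)
    (hxy : ∀ j, j ≠ c → Γ.sameCycle c j x y) :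
    ∃ F : XX n c → Γ.RealSp Set.univ, Continuous F ∧
      (∀ q : XX n c, q.1.2 = 0 → F q = Γ.mkp x ⟨q.1.1, q.2.1⟩) ∧
      (∀ q : XX n c, q.1.2 = 1 → F q = Γ.mkp y ⟨q.1.1, q.2.1⟩) ∧
      (∀ q : XX n c, ∀ j, j ≠ c → q.1.1 j = 0 → F q = Γ.mkp x ⟨q.1.1, q.2.1⟩) := by
  -- a point of the open simplex at `x`
  let b : stdSimplex ℝ (Fin (n + 1)) := ⟨fun _ => (1 : ℝ) / (n + 1), fun _ => by positivity, by
    simp; field_simp⟩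
  let p0 := Γ.mkp x b
  have : Fact (Module.finrank ℝ (EuclideanSpace ℝ (Fin (n + 1))) = n + 1) := ⟨by simp⟩
  let st := stereographic' n (e p0)
  have hsrc : st.source = {e p0}ᶜ := stereographic'_source _
  have htgt : st.target = Set.univ := stereographic'_target _
  have hne : ∀ (v : V) (q : XX n c), e (Γ.mkp v ⟨q.1.1, q.2.1⟩) ∈ st.source := by
    intro v q
    rw [hsrc]
    intro h
    have h1 : Γ.mkp v ⟨q.1.1, q.2.1⟩ = p0 := e.injective h
    have h2 := congrArg (fun p => Γ.coord p c) h1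
    have h3 : q.1.1 c = (1 : ℝ) / (n + 1) := h2
    have h4 : q.1.1 c = 0 := q.2.2.1
    have : (0 : ℝ) < 1 / (n + 1) := by positivity
    linarith
  let g : V → XX n c → EuclideanSpace ℝ (Fin n) := fun v q => st (e (Γ.mkp v ⟨q.1.1, q.2.1⟩))
  have hg : ∀ v, Continuous (g v) := by
    intro v
    apply st.continuousOn.comp_continuous
    · apply e.continuous.comp
      apply (Γ.mkp_continuous v).comp
      exact Continuous.subtype_mk (continuous_fst.comp continuous_subtype_val) _
    · exact hne v
  have hback : ∀ v q, e.symm (st.symm (g v q)) = Γ.mkp v ⟨q.1.1, q.2.1⟩ := by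
    intro v q
    rw [st.left_inv (hne v q), e.symm_apply_apply]
  refine ⟨fun q => e.symm (st.symm ((1 - q.1.2) • g x q + q.1.2 • g y q)), ?_, ?_, ?_, ?_⟩
  · apply e.symm.continuous.comp
    apply st.continuousOn_symm.comp_continuous
    · have := hg x
      have := hg y
      fun_prop
    · intro q
      rw [htgt]
      trivial
  · intro q hq
    simp only [hq]
    rw [sub_zero, one_smul, zero_smul, add_zero, hback]
  · intro q hq
    simp only [hq]
    rw [sub_self, one_smul, zero_smul, zero_add, hback]
  · intro q j hj hq
    have : g y q = g x q := by
      simp only [g]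
      rw [Γ.mkp_reach {c, j} x y (hxy j hj)]
      rintro d (rfl | rfl)
      · exact q.2.2.1
      · exact hq
    simp only [this]
    rw [← add_smul, sub_add_cancel, one_smul, hback]

open Classical in
lemma main_aux (hn : 1 ≤ n) (e : Γ.RealSp Set.univ ≃ₜ sphereType n) (c : Fin (n + 1)) (x y : V)
    (hxy : ∀ j, j ≠ c → Γ.sameCycle c j x y)
    (φ : Fin (n + 1) → V → ZMod 2) (hφ : ∀ d v, φ d (Γ.inv d v) = φ d v)
    (hsum : ∀ v, ∑ d, φ d v = 0) : φ c x = φ c y := by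
  obtain ⟨F, hF, hF0, hF1, hFs⟩ := Γ.exists_homotopy e c x y hxy
  have hpos : (0 : ℝ) < 1 / (n + 1) := by positivity
  let U : XX n c → Set (XX n c) := fun q =>
    {q' | ∀ j, |Γ.coord (F q') j - Γ.coord (F q) j| < 1 / (n + 1)} ∩
    {q' | ∀ d, (∀ j, j ≠ d → 0 < Γ.coord (F q) j) →
      (Γ.phi φ hφ d (F q') = Γ.phi φ hφ d (F q) ∧ ∀ j, j ≠ d → 0 < Γ.coord (F q') j)}
  have hUo : ∀ q, IsOpen (U q) := by
    intro q
    apply IsOpen.inter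
    · simp only [Set.ofPred_forall]
      refine isOpen_iInter_of_finite fun j => isOpen_lt ?_ continuous_const
      have : Continuous fun q' => Γ.coord (F q') j :=
        (continuous_apply j).comp (Γ.coord_continuous.comp hF)
      fun_prop
    · simp only [Set.ofPred_forall]
      refine isOpen_iInter_of_finite fun d => isOpen_iInter_of_finite fun _ => ?_
      exact (Γ.isOpen_phi φ hφ d _).preimage hF
  have hUm : ∀ q, q ∈ U q := by
    intro q
    refine ⟨?_, ?_⟩
    · intro j
      simpa using hpos
    · intro d hd
      exact ⟨rfl, hd⟩
  have : CompactSpace (XX n c) := isCompact_iff_compactSpace.1 (XX_compact n c)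
  obtain ⟨δ, hδ, hleb⟩ := lebesgue_number_lemma_of_metric (s := (Set.univ : Set (XX n c)))
    isCompact_univ hUo (fun q _ => Set.mem_iUnion.2 ⟨q, hUm q⟩)
  let l : (Fin (n + 1) → ℝ) × ℝ → Fin (n + 1) := fun q =>
    if h : q ∈ XX n c then lab (Γ.coord (F ⟨q, h⟩)) else 0
  let Φ : Fin (n + 1) → (Fin (n + 1) → ℝ) × ℝ → ZMod 2 := fun d q =>
    if h : q ∈ XX n c then Γ.phi φ hφ d (F ⟨q, h⟩) else 0
  have hl : ∀ q (h : q ∈ XX n c), l q = lab (Γ.coord (F ⟨q, h⟩)) := fun q h => dif_pos h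
  have hΦ : ∀ d q (h : q ∈ XX n c), Φ d q = Γ.phi φ hφ d (F ⟨q, h⟩) := fun d q h => dif_pos h
  have small : ∀ A, ∀ hA : A ⊆ XX n c, A.Nonempty → (∀ q ∈ A, ∀ q' ∈ A, dist q q' < δ) →
      ∃ p : Γ.RealSp Set.univ, (∀ q ∈ A, 0 < Γ.coord p (l q)) ∧
        ∀ d, (∀ j, j ≠ d → 0 < Γ.coord p j) → ∀ q (hq : q ∈ A),
          Φ d q = Γ.phi φ hφ d p ∧ ∀ j, j ≠ d → 0 < Γ.coord (F ⟨q, hA hq⟩) j := by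
    rintro A hA ⟨q0, hq0⟩ hdist
    obtain ⟨q, hq⟩ := hleb ⟨q0, hA hq0⟩ trivial
    have hin : ∀ q' (hq' : q' ∈ A), (⟨q', hA hq'⟩ : XX n c) ∈ U q :=
      fun q' hq' => hq (hdist q' hq' q0 hq0)
    refine ⟨F q, ?_, ?_⟩
    · intro q' hq'
      have h1 := (hin q' hq').1 (l q')
      have h2 := lab_ge _ (Γ.coord_mem (F ⟨q', hA hq'⟩))
      rw [← hl] at h2
      rw [abs_lt] at h1
      linarith [h1.2]
    · intro d hd q' hq'
      rw [hΦ d q' (hA hq')]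
      exact (hin q' hq').2 d hd
  have hlabpos : ∀ q (h : q ∈ XX n c), Γ.coord (F ⟨q, h⟩) = q.1 → q.1 (l q) ≠ 0 := by
    intro q h hc
    have h2 := lab_ge _ (Γ.coord_mem (F ⟨q, h⟩))
    rw [← hl q h, hc] at h2
    linarith
  have hmain := core hn c l Φ δ hδ ?_ ?_ (fun s => if s = 0 then φ c x else φ c y) ?_
  · simpa using hmain
  · intro q hq hcase
    apply hlabpos q hq
    rcases hcase with h | h | ⟨j, hj, h⟩
    · rw [hF0 _ h]; rfl
    · rw [hF1 _ h]; rfl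
    · rw [hFs _ j hj h]; rfl
  · intro A hA hne hdist
    obtain ⟨p, h1, h2⟩ := small A hA hne hdist
    refine ⟨fun d => Γ.phi φ hφ d p, Finset.univ.filter (fun j => 0 < Γ.coord p j), ?_, ?_, ?_⟩
    · intro q hq
      simpa using h1 q hq
    · intro d hd q hq
      refine (h2 d ?_ q hq).1
      intro j hj
      have := hd (show j ∈ ({d}ᶜ : Finset _) by simpa using hj)
      simpa using this
    · intro hT
      have hall : ∀ j, 0 < Γ.coord p j := by
        intro j
        have : j ∈ Finset.univ.filter (fun j => 0 < Γ.coord p j) := by rw [hT]; simp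
        simpa using this
      clear h1 h2
      induction p using Quot.ind with
      | mk a =>
        rw [← hsum a.1.1]
        exact Finset.sum_congr rfl fun d _ => Γ.phi_mkp φ hφ d a.1.1 a.2 (fun j _ => hall j)
  · intro s hs A hA hAs hdist hlab q hq
    obtain ⟨p, h1, h2⟩ := small A hA ⟨q, hq⟩ hdist
    have h3 := h2 c (by
      intro j hj
      obtain ⟨q', hq', rfl⟩ := hlab j hj
      exact h1 q' hq') q hq
    have h4 := h3.2
    rw [hΦ c q (hA hq)]
    have hqs := hAs q hq
    rcases hs with rfl | rfl
    · rw [hF0 ⟨q, hA hq⟩ hqs] at h4 ⊢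
      rw [if_pos rfl]
      exact Γ.phi_mkp φ hφ c x _ h4
    · rw [hF1 ⟨q, hA hq⟩ hqs] at h4 ⊢
      rw [if_neg one_ne_zero]
      exact Γ.phi_mkp φ hφ c y _ h4

end PCG

/-- A crystallization of the `n`-sphere, `n ≥ 2`, contains no `ρₙ`-pair. -/
theorem stmt11 {n : ℕ} {V : Type} [Fintype V] (hn : 2 ≤ n) (Γ : PCG n V)
    (hcr : Γ.IsCrystallization (sphereType n)) :
    ¬∃ (c : Fin (n + 1)) (x y : V), Γ.IsRhoN c x y := by
  classical
  rintro ⟨c, x, y, ⟨hne1, hne2⟩, hxy⟩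
  obtain ⟨⟨e⟩, hconn⟩ := hcr
  obtain ⟨φ, h1, h2, h3⟩ := Γ.exists_cochain c x (Γ.inv c x) (hconn c _ _)
  have hx := Γ.fixedfree c x
  have key := Γ.main_aux (by omega) e c x y hxy
    (fun d v => φ d v + if d = c then
      ((if v = x then 1 else 0) + (if v = Γ.inv c x then 1 else 0)) else 0) (by
      intro d v
      simp only [h1]
      by_cases hdc : d = c
      · subst hdc
        have e1 : (Γ.inv d v = x) ↔ (v = Γ.inv d x) :=
          ⟨fun h => by rw [← h, Γ.involutive d v], fun h => by rw [h, Γ.involutive d x]⟩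
        have e2 : (Γ.inv d v = Γ.inv d x) ↔ (v = x) := (Γ.involutive d).injective.eq_iff
        simp only [e1, e2, if_true]
        rw [add_comm (if v = Γ.inv d x then (1 : ZMod 2) else 0)]
      · simp [hdc]) (by
      intro v
      simp only [Finset.sum_add_distrib, h3, Finset.sum_ite_eq', Finset.mem_univ, if_true]
      exact ZModModule.add_self _)
  simp [h2, hne1, hne2, hx.symm] at key
end
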